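/- arXiv:2406.06892 — 2 statements merged into one kernel-verified Lean document; each statement's English description precedes it below -/
import Mathlib

section
/- Let c ∈ (0, 1/3). For every ε > 0 there exists a constant C > 0 (depending only on ε and c) such that the following holds: for all coprime positive integers a, b with ℓ := a/b > 1 and ℓ ∉ Σ, for every real x ≥ 1 with ℓ ≤ x^c, and for every increasing unbounded function k : [1,∞) → (0,∞) satisfying k(y) ≤ y^c for all y ≥ 1, one has #W(ℓ;k;x) ≤ C · a · b³ · x^{2/3 + c + ε}. -/
/-- `sigma1 n` is the sum of the positive divisors of `n`. -/
noncomputable def sigma1 (n : ℕ) : ℕ := ArithmeticFunction.sigma 1 n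

/-- `#W(ℓ;k;x)`: the number of `(ℓ;k)`-within-perfect numbers up to `x`. -/
noncomputable def withinPerfectCount (ℓ : ℝ) (k : ℝ → ℝ) (x : ℝ) : ℕ :=
  {n : ℕ | 1 ≤ n ∧ (n : ℝ) ≤ x ∧ |(sigma1 n : ℝ) - ℓ * n| < k n}.ncard

/-- `Σ = {σ(m)/m : m ≥ 1}`. -/
def sigmaRatioSet : Set ℝ := {q : ℝ | ∃ m : ℕ, 0 < m ∧ q = (sigma1 m : ℝ) / m}


lemma aux_count_mod (s : Finset ℕ) (r X : ℕ) (h1 : ∀ e ∈ s, e ≤ X)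
    (h2 : ∀ e ∈ s, ∀ f ∈ s, e ≡ f [MOD r]) : s.card ≤ X / r + 1 := by
  have := Finset.card_le_card_of_injOn (s := s) (t := Finset.range (X / r + 1)) (fun e => e / r)
    (by
      intro e he
      have := Nat.div_le_div_right (c := r) (h1 e he)
      simp
      omega)
    (by
      intro e he f hf hef
      have h := h2 e he f hf
      have h3 := Nat.div_add_mod e r
      have h4 := Nat.div_add_mod f r
      unfold Nat.ModEq at h
      simp only at hef
      rw [← h3, ← h4, hef, h])
  simpa using this

lemma aux_fixed (E : Finset ℕ) (s A X : ℕ) (hs : 0 < s) (K : ℝ) (hK : 0 ≤ K)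
    (h1 : ∀ e ∈ E, e ≤ X)
    (h2 : ∀ e ∈ E, ∃ t : ℤ, (s : ℤ) * t - A * e ≠ 0 ∧ |((s * t - A * e : ℤ) : ℝ)| ≤ K) :
    (E.card : ℝ) ≤ 2 * K + 2 * K * X / s := by
  set g := Nat.gcd s A with hg
  have hgpos : 0 < g := Nat.gcd_pos_of_pos_left _ hs
  have hgR : (0 : ℝ) < g := by exact_mod_cast hgpos
  obtain ⟨s', hs'⟩ : g ∣ s := Nat.gcd_dvd_left _ _
  have hs'pos : 0 < s' := by
    rcases Nat.eq_zero_or_pos s' with h | h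
    · subst h; omega
    · exact h
  have hgs : (g : ℤ) ∣ s := by exact_mod_cast Nat.gcd_dvd_left s A
  have hgA : (g : ℤ) ∣ A := by exact_mod_cast Nat.gcd_dvd_right s A
  have h2' : ∀ e : ℕ, ∃ t : ℤ, e ∈ E →
      (s : ℤ) * t - A * e ≠ 0 ∧ |((s * t - A * e : ℤ) : ℝ)| ≤ K := by
    intro e
    by_cases he : e ∈ E
    · obtain ⟨t, ht⟩ := h2 e he
      exact ⟨t, fun _ => ht⟩
    · exact ⟨0, fun h => absurd h he⟩
  choose t ht using h2'
  have hdv : ∀ e : ℕ, (g : ℤ) ∣ (s : ℤ) * t e - A * e := fun e =>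
    dvd_sub (Dvd.dvd.mul_right hgs _) (Dvd.dvd.mul_right hgA _)
  choose j hj using hdv
  set J : ℕ := ⌊K / g⌋₊ with hJ
  have hmaps : ∀ e ∈ E, j e ∈ (Finset.Icc (-(J : ℤ)) J).erase 0 := by
    intro e he
    obtain ⟨h3, h4⟩ := ht e he
    rw [hj e] at h3 h4
    have h5 : j e ≠ 0 := by
      intro h; rw [h] at h3; simp at h3
    have h6 : |j e| ≤ J := by
      have : (j e).natAbs ≤ J := by
        apply Nat.le_floor
        rw [le_div_iff₀ hgR, Nat.cast_natAbs]
        push_cast at h4 ⊢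
        rw [abs_mul, abs_of_pos hgR] at h4
        linarith
      rw [Int.abs_eq_natAbs]
      exact_mod_cast this
    rw [abs_le] at h6
    simp [h5, h6.1, h6.2]
  have hfib : ∀ i ∈ (Finset.Icc (-(J : ℤ)) J).erase 0,
      (E.filter (fun e => j e = i)).card ≤ X / s' + 1 := by
    intro i _
    apply aux_count_mod
    · intro e he
      exact h1 e (Finset.mem_filter.1 he).1
    · intro e he f hf
      have h3 := (Finset.mem_filter.1 he).2
      have h4 := (Finset.mem_filter.1 hf).2
      have h5 : A * e ≡ A * f [MOD s] := by
        rw [Nat.modEq_iff_dvd]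
        refine ⟨t f - t e, ?_⟩
        have h6 := hj e
        have h7 := hj f
        rw [h3] at h6
        rw [h4] at h7
        push_cast
        linarith
      have h6 := Nat.ModEq.cancel_left_div_gcd hs h5
      have h7 : s / Nat.gcd s A = s' := by
        rw [← hg]
        exact Nat.div_eq_of_eq_mul_right hgpos hs'
      rwa [h7] at h6
  have hcard := Finset.card_le_mul_card_image_of_maps_to hmaps _ hfib
  have hc2 : ((Finset.Icc (-(J : ℤ)) J).erase 0).card = 2 * J := by
    rw [Finset.card_erase_of_mem (by simp)]
    simp
    omega
  rw [hc2] at hcard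
  have hcR : (E.card : ℝ) ≤ ((X / s' : ℕ) + 1) * (2 * J) := by exact_mod_cast hcard
  have hJ1 : (J : ℝ) ≤ K / g := Nat.floor_le (by positivity)
  have hX : ((X / s' : ℕ) : ℝ) ≤ X / s' := Nat.cast_div_le
  have hs'R : (0 : ℝ) < s' := by exact_mod_cast hs'pos
  have hsR : (s : ℝ) = g * s' := by exact_mod_cast hs'
  have hKg : K / g ≤ K := div_le_self hK (by exact_mod_cast hgpos)
  calc (E.card : ℝ) ≤ ((X / s' : ℕ) + 1) * (2 * J) := hcR
    _ ≤ (X / s' + 1) * (2 * (K / g)) := by gcongr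
    _ = 2 * (K / g) + 2 * K * X / s := by rw [hsR]; field_simp; ring
    _ ≤ _ := by linarith

lemma aux_unitary (y : ℝ) (hy : 1 ≤ y) (n : ℕ) : y < n →
    ∃ d e : ℕ, n = d * e ∧ Nat.Coprime d e ∧ y < d ∧
      ((d : ℝ) ≤ y ^ 2 ∨ (y ^ 2 < d ∧ ∃ p k : ℕ, p.Prime ∧ k ≠ 0 ∧ d = p ^ k)) := by
  induction n using Nat.strong_induction_on with
  | _ n ih =>
  intro hn
  by_cases h : (n : ℝ) ≤ y ^ 2
  · exact ⟨n, 1, by simp, by simp, hn, Or.inl h⟩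
  push Not at h
  have hn1 : 1 < n := by
    have : (1 : ℝ) < n := by linarith
    exact_mod_cast this
  have hp := Nat.minFac_prime (n := n) (by omega)
  set p := n.minFac with hpdef
  have hpn : p ∣ n := Nat.minFac_dvd n
  obtain ⟨v, m, hm, hnm⟩ := Nat.exists_eq_pow_mul_and_not_dvd (n := n) (by omega) p hp.ne_one
  have hv : v ≠ 0 := by
    intro hv
    rw [hv] at hnm
    simp at hnm
    exact hm (hnm ▸ hpn)
  have hcop : Nat.Coprime (p ^ v) m := Nat.Coprime.pow_left _ ((Nat.Prime.coprime_iff_not_dvd hp).2 hm)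
  by_cases hq : y < ((p ^ v : ℕ) : ℝ)
  · refine ⟨p ^ v, m, hnm, hcop, hq, ?_⟩
    by_cases hq2 : ((p ^ v : ℕ) : ℝ) ≤ y ^ 2
    · exact Or.inl hq2
    · exact Or.inr ⟨not_le.1 hq2, p, v, hp, hv, rfl⟩
  · push Not at hq
    have hq1 : 1 < p ^ v := Nat.one_lt_pow hv hp.one_lt
    have hm0 : 0 < m := by
      rcases Nat.eq_zero_or_pos m with h0 | h0
      · subst h0; omega
      · exact h0
    have hmn : m < n := by
      rw [hnm]; nlinarith
    have hym : y < m := by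
      have h3 : (n : ℝ) = ((p ^ v : ℕ) : ℝ) * m := by exact_mod_cast hnm
      have hm0R : (0 : ℝ) < m := by exact_mod_cast hm0
      by_contra hcon
      push Not at hcon
      have : (n : ℝ) ≤ y * y := by
        rw [h3]; gcongr
      nlinarith
    obtain ⟨d, e, h1, h2, h3, h4⟩ := ih m hmn hym
    refine ⟨d, p ^ v * e, by rw [hnm, h1]; ring, ?_, h3, h4⟩
    apply Nat.Coprime.mul_right _ h2
    exact (Nat.Coprime.coprime_dvd_right ⟨e, h1⟩ hcop).symm

lemma aux_sqrt (M : ℕ) : ∑ m ∈ Finset.Icc 1 M, 1 / √(m : ℝ) ≤ 2 * √(M : ℝ) := by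
  induction M with
  | zero => simp
  | succ M ih =>
    rw [Finset.sum_Icc_succ_top (by omega)]
    have h1 : (0 : ℝ) < √((M + 1 : ℕ) : ℝ) := Real.sqrt_pos.2 (by positivity)
    have h2 : √((M + 1 : ℕ) : ℝ) * √((M + 1 : ℕ) : ℝ) = M + 1 := by
      rw [Real.mul_self_sqrt (by positivity)]; push_cast; ring
    have h3 : √(M : ℝ) * √(M : ℝ) = M := Real.mul_self_sqrt (by positivity)
    have h4 : 1 / √((M + 1 : ℕ) : ℝ) ≤ 2 * √((M + 1 : ℕ) : ℝ) - 2 * √(M : ℝ) := by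
      rw [div_le_iff₀ h1]
      nlinarith [sq_nonneg (√((M + 1 : ℕ) : ℝ) - √(M : ℝ))]
    linarith

lemma sigma1_mul {d e : ℕ} (h : Nat.Coprime d e) : sigma1 (d * e) = sigma1 d * sigma1 e :=
  ArithmeticFunction.isMultiplicative_sigma.map_mul_of_coprime h

lemma sigma1_prime {p : ℕ} (h : p.Prime) : sigma1 p = p + 1 := by
  unfold sigma1
  rw [ArithmeticFunction.sigma_one_apply, h.sum_divisors]
  try ring

lemma le_sigma1 {d : ℕ} (h : 0 < d) : d ≤ sigma1 d := by
  unfold sigma1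
  rw [ArithmeticFunction.sigma_one_apply]
  exact Finset.single_le_sum (f := fun i => i) (fun _ _ => Nat.zero_le _)
    (Nat.mem_divisors_self d h.ne')

/-- numbers with a unitary divisor in the middle range -/
lemma aux_S2 (a b : ℕ) (y K : ℝ) (hy : 1 ≤ y) (hK : 0 ≤ K)
    (hD : ∀ n : ℕ, 1 ≤ n → (b : ℤ) * sigma1 n - a * n ≠ 0) (S : Finset ℕ)
    (hS : ∀ n ∈ S, 1 ≤ n ∧ (n : ℝ) ≤ y ^ 3 ∧ |(((b : ℤ) * sigma1 n - a * n : ℤ) : ℝ)| ≤ K)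
    (hU : ∀ n ∈ S, ∃ d e : ℕ, n = d * e ∧ Nat.Coprime d e ∧ y < d ∧ (d : ℝ) ≤ y ^ 2) :
    (S.card : ℝ) ≤ 6 * K * y ^ 2 := by
  classical
  set E : ℕ → Finset ℕ := fun d => (Finset.Icc 1 ⌊y ^ 3 / d⌋₊).filter
    (fun e => Nat.Coprime d e ∧ |(((b : ℤ) * sigma1 (d * e) - a * (d * e : ℕ) : ℤ) : ℝ)| ≤ K) with hE
  set R := Finset.Ioo ⌊y⌋₊ (⌊y ^ 2⌋₊ + 1) with hR
  have hy0 : 0 < y := by linarith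
  have hsub : S ⊆ R.biUnion (fun d => (E d).image (fun e => d * e)) := by
    intro n hn
    obtain ⟨d, e, h1, h2, h3, h4⟩ := hU n hn
    obtain ⟨h5, h6, h7⟩ := hS n hn
    have hd : (0 : ℝ) < d := by linarith
    have he : 1 ≤ e := by
      rcases Nat.eq_zero_or_pos e with h | h
      · subst h; omega
      · exact h
    subst h1
    simp only [Finset.mem_biUnion, Finset.mem_image, hE, Finset.mem_filter, Finset.mem_Icc, hR,
      Finset.mem_Ioo]
    refine ⟨d, ⟨(Nat.floor_lt hy0.le).2 h3, Nat.lt_succ_of_le (Nat.le_floor h4)⟩, e,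
      ⟨⟨he, ?_⟩, h2, h7⟩, rfl⟩
    apply Nat.le_floor
    rw [le_div_iff₀ hd]
    push_cast at h6
    linarith
  have hEd : ∀ d ∈ R, ((E d).card : ℝ) ≤ 2 * K + 2 * K * y ^ 3 * ((d : ℝ) ^ 2)⁻¹ := by
    intro d hd
    have hd0 : 0 < d := by
      have := (Finset.mem_Ioo.1 hd).1
      omega
    have hdR : (0 : ℝ) < d := by exact_mod_cast hd0
    have hsd := le_sigma1 hd0
    have h := aux_fixed (E d) (sigma1 d) (a * d) ⌊y ^ 3 / d⌋₊ (by omega) K hK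
      (fun e he => (Finset.mem_Icc.1 (Finset.mem_filter.1 he).1).2)
      (by
        intro e he
        obtain ⟨h1, h2, h3⟩ := Finset.mem_filter.1 he
        have he1 := (Finset.mem_Icc.1 h1).1
        have heq : ((sigma1 d : ℤ)) * ((b : ℤ) * sigma1 e) - ((a * d : ℕ) : ℤ) * e
            = (b : ℤ) * sigma1 (d * e) - a * (d * e : ℕ) := by
          rw [sigma1_mul h2]; push_cast; ring
        refine ⟨(b : ℤ) * sigma1 e, ?_, ?_⟩
        · rw [heq]
          exact hD _ (Nat.mul_pos hd0 he1)
        · rw [heq]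
          exact h3)
    refine h.trans ?_
    have hfl : ((⌊y ^ 3 / d⌋₊ : ℕ) : ℝ) ≤ y ^ 3 / d := Nat.floor_le (by positivity)
    have hsR : (d : ℝ) ≤ sigma1 d := by exact_mod_cast hsd
    have : 2 * K * (⌊y ^ 3 / d⌋₊ : ℕ) / (sigma1 d : ℝ) ≤ 2 * K * (y ^ 3 / d) / d := by
      gcongr
    have h2 : 2 * K * (y ^ 3 / d) / d = 2 * K * y ^ 3 * ((d : ℝ) ^ 2)⁻¹ := by
      field_simp
    linarith
  have hc1 : S.card ≤ ∑ d ∈ R, (E d).card :=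
    (Finset.card_le_card hsub).trans (Finset.card_biUnion_le.trans
      (Finset.sum_le_sum fun d _ => Finset.card_image_le))
  have hRc : (R.card : ℝ) ≤ y ^ 2 := by
    have : R.card ≤ ⌊y ^ 2⌋₊ := by
      rw [hR, Nat.card_Ioo]; omega
    calc (R.card : ℝ) ≤ (⌊y ^ 2⌋₊ : ℕ) := by exact_mod_cast this
      _ ≤ _ := Nat.floor_le (by positivity)
  have hsum : ∑ d ∈ R, ((d : ℝ) ^ 2)⁻¹ ≤ 2 / y := by
    refine (sum_Ioo_inv_sq_le (α := ℝ) ⌊y⌋₊ (⌊y ^ 2⌋₊ + 1)).trans ?_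
    have := Nat.lt_floor_add_one y
    gcongr
  calc (S.card : ℝ) ≤ ∑ d ∈ R, ((E d).card : ℝ) := by exact_mod_cast hc1
    _ ≤ ∑ d ∈ R, (2 * K + 2 * K * y ^ 3 * ((d : ℝ) ^ 2)⁻¹) := Finset.sum_le_sum hEd
    _ = R.card * (2 * K) + 2 * K * y ^ 3 * ∑ d ∈ R, ((d : ℝ) ^ 2)⁻¹ := by
      rw [Finset.sum_add_distrib, Finset.sum_const, nsmul_eq_mul, Finset.mul_sum]
    _ ≤ y ^ 2 * (2 * K) + 2 * K * y ^ 3 * (2 / y) := by gcongr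
    _ = 6 * K * y ^ 2 := by field_simp; ring

/-- numbers with a large prime factor exactly dividing them -/
lemma aux_S3 (a b : ℕ) (y K : ℝ) (hy : 1 ≤ y) (hK : 0 ≤ K)
    (hD : ∀ n : ℕ, 1 ≤ n → (b : ℤ) * sigma1 n - a * n ≠ 0) (S : Finset ℕ)
    (hS : ∀ n ∈ S, 1 ≤ n ∧ (n : ℝ) ≤ y ^ 3 ∧ |(((b : ℤ) * sigma1 n - a * n : ℤ) : ℝ)| ≤ K)
    (hU : ∀ n ∈ S, ∃ p m : ℕ, n = p * m ∧ Nat.Coprime p m ∧ y ^ 2 < p ∧ p.Prime) :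
    (S.card : ℝ) ≤ y * (2 * K + 1) := by
  classical
  set F : ℕ × ℤ → ℕ := fun q =>
    q.1 * ((q.2 - (b : ℤ) * sigma1 q.1) / ((b : ℤ) * sigma1 q.1 - a * q.1)).toNat with hF
  have hsub : S ⊆ (Finset.Icc 1 ⌊y⌋₊ ×ˢ Finset.Icc (-(⌊K⌋₊ : ℤ)) ⌊K⌋₊).image F := by
    intro n hn
    obtain ⟨p, m, h1, h2, h3, h4⟩ := hU n hn
    obtain ⟨h5, h6, h7⟩ := hS n hn
    have hm : 1 ≤ m := by
      rcases Nat.eq_zero_or_pos m with h | h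
      · subst h; omega
      · exact h
    have hmy : (m : ℝ) ≤ y := by
      have h8 : (n : ℝ) = p * m := by exact_mod_cast h1
      by_contra hcon
      push Not at hcon
      have : y ^ 2 * y < p * m := by gcongr
      nlinarith
    rw [Finset.mem_image]
    refine ⟨(m, (b : ℤ) * sigma1 n - a * n), ?_, ?_⟩
    · have h8 : ((b : ℤ) * sigma1 n - a * n).natAbs ≤ ⌊K⌋₊ := by
        apply Nat.le_floor
        rw [Nat.cast_natAbs, Int.cast_abs]
        exact h7
      rw [Finset.mem_product, Finset.mem_Icc, Finset.mem_Icc]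
      refine ⟨⟨hm, Nat.le_floor hmy⟩, ?_, ?_⟩ <;> simp only <;> omega
    · have h8 : (b : ℤ) * sigma1 n - a * n - (b : ℤ) * sigma1 m
          = ((b : ℤ) * sigma1 m - a * m) * p := by
        rw [h1, sigma1_mul h2, sigma1_prime h4]; push_cast; ring
      simp only [hF]
      rw [h8, Int.mul_ediv_cancel_left _ (hD m hm), Int.toNat_natCast, h1, mul_comm]
  have hc := (Finset.card_le_card hsub).trans Finset.card_image_le
  rw [Finset.card_product, Nat.card_Icc, Int.card_Icc] at hc
  have h9 : ((⌊K⌋₊ : ℤ) + 1 - -(⌊K⌋₊ : ℤ)).toNat = 2 * ⌊K⌋₊ + 1 := by omega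
  rw [h9, Nat.add_sub_cancel] at hc
  have h10 : ((⌊K⌋₊ : ℕ) : ℝ) ≤ K := Nat.floor_le hK
  have h11 : ((⌊y⌋₊ : ℕ) : ℝ) ≤ y := Nat.floor_le (by linarith)
  calc (S.card : ℝ) ≤ (⌊y⌋₊ : ℕ) * (2 * (⌊K⌋₊ : ℕ) + 1) := by exact_mod_cast hc
    _ ≤ _ := by gcongr

/-- numbers divisible by a large proper prime power -/
lemma aux_S4 (y : ℝ) (hy : 1 ≤ y) (S : Finset ℕ)
    (hS : ∀ n ∈ S, 1 ≤ n ∧ (n : ℝ) ≤ y ^ 3)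
    (hU : ∀ n ∈ S, ∃ p k m : ℕ, n = p ^ k * m ∧ y ^ 2 < (p ^ k : ℕ) ∧ p.Prime ∧ 2 ≤ k) :
    (S.card : ℝ) ≤ 2 * (Nat.log 2 ⌊y ^ 3⌋₊ : ℕ) * y ^ 2 := by
  classical
  set L := Nat.log 2 ⌊y ^ 3⌋₊ with hL
  have hy0 : 0 < y := by linarith
  have hsub : S ⊆ (Finset.Icc 1 ⌊y⌋₊).biUnion (fun m =>
      (Finset.Icc 2 L ×ˢ Finset.Icc 1 ⌊√(y ^ 3 / m)⌋₊).image (fun q => q.2 ^ q.1 * m)) := by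
    intro n hn
    obtain ⟨p, k, m, h1, h2, h3, h4⟩ := hU n hn
    obtain ⟨h5, h6⟩ := hS n hn
    have hm : 1 ≤ m := by
      rcases Nat.eq_zero_or_pos m with h | h
      · subst h; omega
      · exact h
    have hmR : (0 : ℝ) < m := by exact_mod_cast hm
    have h8 : (n : ℝ) = (p ^ k : ℕ) * m := by exact_mod_cast h1
    have hmy : (m : ℝ) ≤ y := by
      by_contra hcon
      push Not at hcon
      have : y ^ 2 * y < (p ^ k : ℕ) * m := by gcongr
      nlinarith
    have hpk : p ^ k ≤ n := by rw [h1]; exact Nat.le_mul_of_pos_right _ hm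
    simp only [Finset.mem_biUnion, Finset.mem_image, Finset.mem_product, Finset.mem_Icc]
    refine ⟨m, ⟨hm, Nat.le_floor hmy⟩, (k, p), ⟨⟨h4, ?_⟩, h3.one_lt.le, ?_⟩, h1.symm⟩
    · apply Nat.le_log_of_pow_le (by norm_num)
      calc 2 ^ k ≤ p ^ k := Nat.pow_le_pow_left h3.two_le k
        _ ≤ n := hpk
        _ ≤ _ := Nat.le_floor h6
    · apply Nat.le_floor
      apply Real.le_sqrt_of_sq_le
      rw [le_div_iff₀ hmR]
      have h9 : ((p : ℝ)) ^ 2 ≤ ((p ^ k : ℕ) : ℝ) := by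
        exact_mod_cast Nat.pow_le_pow_right h3.pos h4
      calc (p : ℝ) ^ 2 * m ≤ (p ^ k : ℕ) * m := by gcongr
        _ ≤ y ^ 3 := by rw [← h8]; exact h6
  have hc : S.card ≤ ∑ m ∈ Finset.Icc 1 ⌊y⌋₊, L * ⌊√(y ^ 3 / m)⌋₊ := by
    refine (Finset.card_le_card hsub).trans (Finset.card_biUnion_le.trans
      (Finset.sum_le_sum fun m _ => Finset.card_image_le.trans ?_))
    rw [Finset.card_product, Nat.card_Icc, Nat.card_Icc, Nat.add_sub_cancel]
    gcongr
    omega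
  have h11 : ((⌊y⌋₊ : ℕ) : ℝ) ≤ y := Nat.floor_le (by linarith)
  calc (S.card : ℝ) ≤ ∑ m ∈ Finset.Icc 1 ⌊y⌋₊, (L : ℝ) * (⌊√(y ^ 3 / m)⌋₊ : ℕ) := by
        exact_mod_cast hc
    _ ≤ ∑ m ∈ Finset.Icc 1 ⌊y⌋₊, (L : ℝ) * √(y ^ 3) * (1 / √(m : ℝ)) := by
        apply Finset.sum_le_sum
        intro m _
        rw [mul_assoc]
        gcongr
        refine (Nat.floor_le (Real.sqrt_nonneg _)).trans ?_
        rw [Real.sqrt_div (by positivity), mul_one_div]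
    _ = (L : ℝ) * √(y ^ 3) * ∑ m ∈ Finset.Icc 1 ⌊y⌋₊, (1 / √(m : ℝ)) := by
        rw [Finset.mul_sum]
    _ ≤ (L : ℝ) * √(y ^ 3) * (2 * √y) := by
        gcongr
        refine (aux_sqrt _).trans ?_
        gcongr
    _ = 2 * L * (√(y ^ 3) * √y) := by ring
    _ = 2 * L * y ^ 2 := by
        rw [← Real.sqrt_mul (by positivity), show y ^ 3 * y = (y ^ 2) ^ 2 by ring,
          Real.sqrt_sq (by positivity)]

lemma aux_main (a b : ℕ) (y K : ℝ) (hy : 1 ≤ y) (hK : 0 ≤ K)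
    (hD : ∀ n : ℕ, 1 ≤ n → (b : ℤ) * sigma1 n - a * n ≠ 0) (S : Finset ℕ)
    (hS : ∀ n ∈ S, 1 ≤ n ∧ (n : ℝ) ≤ y ^ 3 ∧ |(((b : ℤ) * sigma1 n - a * n : ℤ) : ℝ)| ≤ K) :
    (S.card : ℝ) ≤ y + 6 * K * y ^ 2 + y * (2 * K + 1)
      + 2 * (Nat.log 2 ⌊y ^ 3⌋₊ : ℕ) * y ^ 2 := by
  classical
  set S1 := S.filter (fun n : ℕ => (n : ℝ) ≤ y) with hS1
  set S2 := S.filter (fun n => ∃ d e : ℕ, n = d * e ∧ Nat.Coprime d e ∧ y < d ∧ (d : ℝ) ≤ y ^ 2)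
    with hS2
  set S3 := S.filter (fun n => ∃ p m : ℕ, n = p * m ∧ Nat.Coprime p m ∧ y ^ 2 < p ∧ p.Prime)
    with hS3
  set S4 := S.filter (fun n => ∃ p k m : ℕ, n = p ^ k * m ∧ y ^ 2 < (p ^ k : ℕ) ∧ p.Prime ∧ 2 ≤ k)
    with hS4
  have hsub : S ⊆ S1 ∪ S2 ∪ S3 ∪ S4 := by
    intro n hn
    simp only [Finset.mem_union, hS1, hS2, hS3, hS4, Finset.mem_filter, hn, true_and]
    by_cases h : (n : ℝ) ≤ y
    · exact Or.inl (Or.inl (Or.inl h))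
    obtain ⟨d, e, h1, h2, h3, h4⟩ := aux_unitary y hy n (not_le.1 h)
    rcases h4 with h4 | ⟨h4, p, k, hp, hk, rfl⟩
    · exact Or.inl (Or.inl (Or.inr ⟨d, e, h1, h2, h3, h4⟩))
    · by_cases hk1 : k = 1
      · subst hk1
        rw [pow_one] at h1 h2 h4
        exact Or.inl (Or.inr ⟨p, e, h1, h2, h4, hp⟩)
      · exact Or.inr ⟨p, k, e, h1, h4, hp, by omega⟩
  have c1 : (S1.card : ℝ) ≤ y := by
    have : S1 ⊆ Finset.Icc 1 ⌊y⌋₊ := by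
      intro n hn
      obtain ⟨h1, h2⟩ := Finset.mem_filter.1 hn
      exact Finset.mem_Icc.2 ⟨(hS n h1).1, Nat.le_floor h2⟩
    have h3 := Finset.card_le_card this
    rw [Nat.card_Icc, Nat.add_sub_cancel] at h3
    calc (S1.card : ℝ) ≤ (⌊y⌋₊ : ℕ) := by exact_mod_cast h3
      _ ≤ y := Nat.floor_le (by linarith)
  have c2 := aux_S2 a b y K hy hK hD S2 (fun n hn => hS n (Finset.mem_filter.1 hn).1)
    (fun n hn => (Finset.mem_filter.1 hn).2)
  have c3 := aux_S3 a b y K hy hK hD S3 (fun n hn => hS n (Finset.mem_filter.1 hn).1)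
    (fun n hn => (Finset.mem_filter.1 hn).2)
  have c4 := aux_S4 y hy S4 (fun n hn => ⟨(hS n (Finset.mem_filter.1 hn).1).1,
    (hS n (Finset.mem_filter.1 hn).1).2.1⟩) (fun n hn => (Finset.mem_filter.1 hn).2)
  have hc : S.card ≤ S1.card + S2.card + S3.card + S4.card := by
    refine (Finset.card_le_card hsub).trans ?_
    have e1 := Finset.card_union_le (S1 ∪ S2 ∪ S3) S4
    have e2 := Finset.card_union_le (S1 ∪ S2) S3
    have e3 := Finset.card_union_le S1 S2
    omega
  have hcR : (S.card : ℝ) ≤ S1.card + S2.card + S3.card + S4.card := by exact_mod_cast hc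
  linarith

theorem stmt_0 (c : ℝ) (hc : 0 < c) (hc' : c < 1 / 3) :
    ∀ ε > (0 : ℝ), ∃ C > (0 : ℝ), ∀ a b : ℕ, 0 < a → 0 < b → Nat.Coprime a b →
      ∀ ℓ : ℝ, ℓ = (a : ℝ) / b → 1 < ℓ → ℓ ∉ sigmaRatioSet →
      ∀ x : ℝ, 1 ≤ x → ℓ ≤ x ^ c →
      ∀ k : ℝ → ℝ, (∀ y : ℝ, 1 ≤ y → 0 < k y) → MonotoneOn k (Set.Ici 1) →
        (∀ M : ℝ, ∃ y : ℝ, 1 ≤ y ∧ M < k y) → (∀ y : ℝ, 1 ≤ y → k y ≤ y ^ c) →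
      (withinPerfectCount ℓ k x : ℝ) ≤ C * a * b ^ 3 * x ^ (2 / 3 + c + ε) := by
  intro ε hε
  refine ⟨10 + 4 / ε, by positivity, ?_⟩
  intro a b ha hb _ ℓ hℓ _ hnot x hx _ k _ _ _ hk
  have hx0 : 0 < x := by linarith
  have hbR : (1 : ℝ) ≤ b := by exact_mod_cast hb
  have haR : (1 : ℝ) ≤ a := by exact_mod_cast ha
  have hb0 : (0 : ℝ) < b := by linarith
  set y : ℝ := x ^ (1 / 3 : ℝ) with hy
  have hy1 : 1 ≤ y := Real.one_le_rpow hx (by norm_num)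
  have hy3 : y ^ 3 = x := by
    rw [hy, ← Real.rpow_natCast, ← Real.rpow_mul hx0.le]; norm_num
  have hy2 : y ^ 2 = x ^ (2 / 3 : ℝ) := by
    rw [hy, ← Real.rpow_natCast, ← Real.rpow_mul hx0.le]; norm_num
  set T : ℝ := x ^ c with hT
  have hT1 : 1 ≤ T := Real.one_le_rpow hx hc.le
  set V : ℝ := x ^ ε with hV
  have hV1 : 1 ≤ V := Real.one_le_rpow hx hε.le
  have hD : ∀ n : ℕ, 1 ≤ n → (b : ℤ) * sigma1 n - a * n ≠ 0 := by
    intro n hn h0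
    apply hnot
    refine ⟨n, hn, ?_⟩
    have hn0 : (0 : ℝ) < n := by exact_mod_cast hn
    have h1 : (b : ℝ) * sigma1 n - a * n = 0 := by exact_mod_cast h0
    rw [hℓ, div_eq_div_iff hb0.ne' hn0.ne']
    linarith
  set W : Set ℕ := {n : ℕ | 1 ≤ n ∧ (n : ℝ) ≤ x ∧ |(sigma1 n : ℝ) - ℓ * n| < k n} with hW
  have hfin : W.Finite := by
    apply (Set.finite_Icc 1 ⌊x⌋₊).subset
    intro n hn
    exact ⟨hn.1, Nat.le_floor hn.2.1⟩
  have hcount : withinPerfectCount ℓ k x = hfin.toFinset.card := by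
    unfold withinPerfectCount
    exact Set.ncard_eq_toFinset_card W hfin
  have hmain := aux_main a b y (b * T) hy1 (by positivity) hD hfin.toFinset (by
    intro n hn
    rw [Set.Finite.mem_toFinset] at hn
    obtain ⟨h1, h2, h3⟩ := hn
    refine ⟨h1, by rw [hy3]; exact h2, ?_⟩
    have hn1 : (1 : ℝ) ≤ n := by exact_mod_cast h1
    have h4 : k n ≤ T := (hk n hn1).trans (Real.rpow_le_rpow (by linarith) h2 hc.le)
    have h5 : (((b : ℤ) * sigma1 n - a * n : ℤ) : ℝ) = b * ((sigma1 n : ℝ) - ℓ * n) := by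
      rw [hℓ]; push_cast; field_simp
    rw [h5, abs_mul, abs_of_pos hb0]
    gcongr
    linarith)
  rw [hcount]
  refine hmain.trans ?_
  rw [hy3]
  have hL : ((Nat.log 2 ⌊x⌋₊ : ℕ) : ℝ) ≤ 2 / ε * V := by
    have h1 : ((Nat.log 2 ⌊x⌋₊ : ℕ) : ℝ) ≤ Real.logb 2 x := by
      rw [Real.le_logb_iff_rpow_le (by norm_num) hx0, Real.rpow_natCast]
      have : 2 ^ Nat.log 2 ⌊x⌋₊ ≤ ⌊x⌋₊ := Nat.pow_log_le_self 2 (Nat.floor_pos.2 hx).ne'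
      calc (2 : ℝ) ^ Nat.log 2 ⌊x⌋₊ ≤ (⌊x⌋₊ : ℕ) := by exact_mod_cast this
        _ ≤ x := Nat.floor_le hx0.le
    have h2 : Real.log x ≤ V / ε := Real.log_le_rpow_div hx0.le hε
    have h3 : 1 / 2 < Real.log 2 := by linarith [Real.log_two_gt_d9]
    have h4 : Real.logb 2 x ≤ 2 / ε * V := by
      rw [Real.logb, div_le_iff₀ (by linarith)]
      have h5 : 0 ≤ V / ε := by positivity
      have : 2 / ε * V * Real.log 2 = (V / ε) * (2 * Real.log 2) := by ring
      rw [this]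
      nlinarith
    linarith
  have hP : x ^ (2 / 3 + c + ε) = y ^ 2 * T * V := by
    rw [hy2, Real.rpow_add hx0, Real.rpow_add hx0]
  rw [hP]
  have hyy : y ≤ y ^ 2 := by nlinarith
  have hb3 : (b : ℝ) ≤ a * b ^ 3 := by
    have : (b : ℝ) ≤ b ^ 3 := le_self_pow₀ hbR (by norm_num)
    nlinarith
  set B : ℝ := a * b ^ 3 with hB
  have hB1 : 1 ≤ B := by linarith
  set Q : ℝ := B * (y ^ 2 * T * V) with hQ
  have hTV : T ≤ T * V := le_mul_of_one_le_right (by linarith) hV1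
  have hVT : V ≤ T * V := le_mul_of_one_le_left (by linarith) hT1
  have q1 : y ^ 2 * (B * (T * V)) = Q := by rw [hQ]; ring
  have hbT : b * T ≤ B * (T * V) := by gcongr
  have hVB : V ≤ B * (T * V) := hVT.trans (le_mul_of_one_le_left (by positivity) hB1)
  have r1 : y ^ 2 * (b * T) ≤ Q := by rw [← q1]; gcongr
  have r2 : y ^ 2 * V ≤ Q := by rw [← q1]; gcongr
  have r3 : y ≤ Q := hyy.trans ((le_mul_of_one_le_right (by positivity) hV1).trans r2)
  have r4 : y * (b * T) ≤ Q := le_trans (by gcongr) r1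
  have r5 : 2 * ((Nat.log 2 ⌊x⌋₊ : ℕ) : ℝ) * y ^ 2 ≤ 4 / ε * Q := by
    calc 2 * ((Nat.log 2 ⌊x⌋₊ : ℕ) : ℝ) * y ^ 2 ≤ 2 * (2 / ε * V) * y ^ 2 := by gcongr
      _ = 4 / ε * (y ^ 2 * V) := by ring
      _ ≤ _ := by gcongr
  have : (10 + 4 / ε) * a * b ^ 3 * (y ^ 2 * T * V) = 10 * Q + 4 / ε * Q := by
    rw [hQ, hB]; ring
  rw [this]
  nlinarith
end

section
/- Let c ∈ (0, 1/3) and let k : [1,∞) → (0,∞) be an increasing unbounded function with k(y) ≤ y^c for all y ≥ 1. Suppose ℓ = a/b ∈ Σ with a, b coprime positive integers, and suppose there exists δ > 0 such that k(y) ≥ y^δ for all y ≥ 1. Then lim_{x→∞} #W(ℓ;k;x) / (x / log x) = ∑_{m ≥ 1 : σ(m) = ℓ·m} 1/m, where the series on the right converges. -/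
section Part1
open Filter Topology MeasureTheory Chebyshev
namespace WP

/-- normalized Chebyshev function in logarithmic scale -/
noncomputable def A (u : ℝ) : ℝ := ψ (Real.exp u) * Real.exp (-u)

lemma A_nonneg (u : ℝ) : 0 ≤ A u := mul_nonneg (psi_nonneg _) (Real.exp_pos _).le

lemma A_le (u : ℝ) : A u ≤ 6 := by
  have h := psi_le_const_mul_self (Real.exp_pos u).le
  have h4 : Real.log 4 ≤ 2 := by
    rw [show (4:ℝ) = 2^2 by norm_num, Real.log_pow]; have := Real.log_two_lt_d9; push_cast; linarith
  unfold A
  rw [Real.exp_neg, ← div_eq_mul_inv, div_le_iff₀ (Real.exp_pos u)]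
  nlinarith [Real.exp_pos u]

lemma A_meas : Measurable A :=
  (psi_mono.measurable.comp Real.measurable_exp).mul (Real.measurable_exp.comp measurable_neg)

lemma A_slow (u h : ℝ) (hh : 0 ≤ h) : Real.exp (-h) * A u ≤ A (u + h) := by
  unfold A
  have : ψ (Real.exp u) ≤ ψ (Real.exp (u+h)) := psi_mono (by gcongr; linarith)
  rw [neg_add, Real.exp_add (-u) (-h)]
  have := mul_le_mul_of_nonneg_right this (mul_pos (Real.exp_pos (-u)) (Real.exp_pos (-h))).le
  linarith

lemma exists_F : ∃ F : ℂ → ℂ, ContinuousOn F {s | 1 ≤ s.re} ∧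
    ∀ s : ℂ, 1 < s.re → LSeries (fun n => (ArithmeticFunction.vonMangoldt n : ℂ)) s
      = F s + 1 / (s - 1) := by
  refine ⟨ArithmeticFunction.vonMangoldt.LFunctionResidueClassAux (1 : ZMod 1),
    ArithmeticFunction.vonMangoldt.continuousOn_LFunctionResidueClassAux _, fun s hs => ?_⟩
  rw [ArithmeticFunction.vonMangoldt.eqOn_LFunctionResidueClassAux (q := 1) isUnit_one hs]
  have : ArithmeticFunction.vonMangoldt.residueClass (1 : ZMod 1) = 
     fun n => ArithmeticFunction.vonMangoldt n := by
    ext n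
    simp [ArithmeticFunction.vonMangoldt.residueClass, Subsingleton.elim (n : ZMod 1) 1]
  simp [this]

lemma integrable_exp_mul {z : ℂ} (hz : 0 < z.re) {B : ℝ → ℝ} (hB : Measurable B) {C : ℝ}
    (hC : ∀ u, |B u| ≤ C) :
    IntegrableOn (fun u : ℝ => (B u : ℂ) * Complex.exp (-z * u)) (Set.Ioi 0) := by
  have h1 : IntegrableOn (fun u : ℝ => Complex.exp (-z * u)) (Set.Ioi 0) :=
    integrableOn_exp_mul_complex_Ioi (by simpa using hz) 0
  refine h1.bdd_mul (c := C) ?_ ?_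
  · exact (Complex.measurable_ofReal.comp hB).aestronglyMeasurable
  · exact Eventually.of_forall fun u => by simpa using hC u

lemma laplace (F : ℂ → ℂ) (hF : ∀ s : ℂ, 1 < s.re →
    LSeries (fun n => (ArithmeticFunction.vonMangoldt n : ℂ)) s = F s + 1 / (s - 1))
    (z : ℂ) (hz : 0 < z.re) :
    ∫ u in Set.Ioi (0:ℝ), ((A u - 1 : ℝ) : ℂ) * Complex.exp (-z * u) = (F (1 + z) - 1) / (1 + z) := by
  have hs : (1:ℝ) < (1 + z).re := by simpa using hz
  have key := LSeries_eq_mul_integral_of_nonneg (fun n => ArithmeticFunction.vonMangoldt n)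
    (r := 1) zero_le_one (s := 1 + z) hs ?_ (fun n => ArithmeticFunction.vonMangoldt_nonneg)
  · rw [hF _ hs] at key
    have h2 : ∫ t in Set.Ioi (1 : ℝ), (∑ k ∈ Finset.Icc 1 ⌊t⌋₊, ((ArithmeticFunction.vonMangoldt k : ℝ) : ℂ))
        * (t:ℂ) ^ (-((1 + z) + 1)) = ∫ u in Set.Ioi (0:ℝ), (A u : ℂ) * Complex.exp (-z * u) := by
      have := integral_comp_log_Ioi (fun u : ℝ => (A u : ℂ) * Complex.exp (-z * u)) (a := 1) one_pos
      rw [Real.log_one] at this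
      rw [← this]
      refine setIntegral_congr_fun measurableSet_Ioi fun t ht => ?_
      have ht0 : (0:ℝ) < t := lt_trans one_pos ht
      have htc : (t:ℂ) ≠ 0 := by exact_mod_cast ht0.ne'
      have e1 : ∑ k ∈ Finset.Icc 1 ⌊t⌋₊, ((ArithmeticFunction.vonMangoldt k : ℝ) : ℂ) = (ψ t : ℂ) := by
        rw [psi, ← Finset.Icc_add_one_left_eq_Ioc]; push_cast; rfl
      simp only [e1, A, Real.exp_log ht0, Real.exp_neg]
      rw [Complex.cpow_def_of_ne_zero htc, ← Complex.ofReal_log ht0.le]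
      have e2 : Complex.exp ((Real.log t : ℂ) * (-(1 + z + 1))) = 
          Complex.exp (-z * (Real.log t : ℂ)) * ((t:ℂ)⁻¹ * (t:ℂ)⁻¹) := by
        have : Complex.exp (-(Real.log t : ℂ)) = (t:ℂ)⁻¹ := by
          rw [Complex.exp_neg, ← Complex.ofReal_exp, Real.exp_log ht0]
        rw [← this, ← Complex.exp_add, ← Complex.exp_add]; congr 1; ring
      rw [e2]
      simp only [Complex.real_smul]
      push_cast
      ring
    rw [h2] at key
    have h3 : ∫ u in Set.Ioi (0:ℝ), Complex.exp (-z * u) = 1 / z := by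
      rw [integral_exp_mul_complex_Ioi (by simpa using hz)]
      simp
    have h4 : ∫ u in Set.Ioi (0:ℝ), ((A u - 1 : ℝ) : ℂ) * Complex.exp (-z * u) = 
       (∫ u in Set.Ioi (0:ℝ), (A u : ℂ) * Complex.exp (-z * u)) - 1 / z := by
      rw [← h3, ← integral_sub]
      · refine integral_congr_ae (Eventually.of_forall fun u => ?_)
        simp only; push_cast; ring
      · exact integrable_exp_mul hz A_meas (C := 6) fun u => by
          rw [abs_of_nonneg (A_nonneg u)]; exact A_le u
      · exact integrableOn_exp_mul_complex_Ioi (by simpa using hz) 0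
    rw [h4]
    have hz0 : z ≠ 0 := by rintro rfl; simp at hz
    have hz1 : 1 + z ≠ 0 := by
      intro h; have := congrArg Complex.re h; simp at this; linarith
    rw [eq_div_iff hz1]
    rw [add_sub_cancel_left] at key
    have : (1 + z) * (1/z) = 1/z + 1 := by field_simp
    linear_combination this * (-1) - key
  · refine Asymptotics.IsBigO.of_bound 6 (Eventually.of_forall fun n => ?_)
    have h := psi_le_const_mul_self (x := n) (Nat.cast_nonneg n)
    have h4 : Real.log 4 ≤ 2 := by
      rw [show (4:ℝ) = 2^2 by norm_num, Real.log_pow]; have := Real.log_two_lt_d9; push_cast; linarith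
    have e1 : ∑ k ∈ Finset.Icc 1 n, ArithmeticFunction.vonMangoldt k = ψ n := by
      rw [psi, ← Finset.Icc_add_one_left_eq_Ioc, Nat.floor_natCast]; rfl
    rw [e1, Real.norm_of_nonneg (psi_nonneg _), Real.rpow_one, Real.norm_of_nonneg (Nat.cast_nonneg n)]
    nlinarith [(Nat.cast_nonneg n : (0:ℝ) ≤ n)]

end WP
end Part1

section Part2
open Filter Topology MeasureTheory
namespace WP

/-- Fejer kernel -/
noncomputable def K (x : ℝ) : ℝ := Real.sinc (x / 2) ^ 2

lemma K_nonneg (x : ℝ) : 0 ≤ K x := sq_nonneg _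

lemma K_cont : Continuous K := (Real.continuous_sinc.comp (by fun_prop)).pow 2

lemma K_bound (x : ℝ) : K x ≤ 5 * (1 + x ^ 2)⁻¹ := by
  have h1 : K x ≤ 1 := by
    have := Real.abs_sinc_le_one (x/2)
    unfold K
    rw [← sq_abs]; nlinarith [abs_nonneg (Real.sinc (x/2))]
  have h2 : x ^ 2 * K x ≤ 4 := by
    by_cases hx : x = 0
    · simp [hx]
    unfold K
    rw [Real.sinc_of_ne_zero (by simpa using hx)]
    have : x^2 * (Real.sin (x/2) / (x/2))^2 = 4 * Real.sin (x/2) ^ 2 := by field_simp; ring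
    rw [this]; nlinarith [Real.sin_sq_le_one (x/2)]
  rw [← div_eq_mul_inv, le_div_iff₀ (by positivity)]
  nlinarith

lemma K_int : Integrable K := by
  refine Integrable.mono' (integrable_inv_one_add_sq.const_mul 5) K_cont.aestronglyMeasurable ?_
  exact Eventually.of_forall fun x => by
    rw [Real.norm_of_nonneg (K_nonneg x)]; exact K_bound x

lemma K_int_pos : 0 < ∫ x, K x := by
  refine integral_pos_of_integrable_nonneg_nonzero (x := 0) K_cont K_int K_nonneg ?_
  simp [K]

lemma K_neg (x : ℝ) : K (-x) = K x := by
  unfold K; rw [neg_div, Real.sinc_neg]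

lemma K_cos (x : ℝ) : ∫ t in (0:ℝ)..1, (1 - t) * Real.cos (t * x) = K x / 2 := by
  by_cases hx : x = 0
  · subst hx
    simp [K]
    rw [intervalIntegral.integral_sub (by simp) (by simp), integral_id]; norm_num
  · have : ∀ t ∈ Set.uIcc (0:ℝ) 1, HasDerivAt
        (fun t => (1 - t) * (Real.sin (t * x) / x) - Real.cos (t * x) / x ^ 2)
        ((1 - t) * Real.cos (t * x)) t := by
      intro t _
      have h0 : HasDerivAt (fun t : ℝ => t * x) x t := by simpa using (hasDerivAt_id t).mul_const x
      have h1 := (h0.sin).div_const x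
      have h2 := (h0.cos).div_const (x^2)
      have h3 : HasDerivAt (fun t : ℝ => 1 - t) (-1) t := by simpa using (hasDerivAt_id t).const_sub 1
      refine ((h3.mul h1).sub h2).congr_deriv ?_
      field_simp
      ring
    rw [intervalIntegral.integral_eq_sub_of_hasDerivAt this (by
      apply Continuous.intervalIntegrable; fun_prop)]
    unfold K
    rw [Real.sinc_of_ne_zero (by simpa using hx)]
    have := Real.cos_sq (x/2)
    have h := Real.sin_sq_add_cos_sq (x/2)
    rw [show 2 * (x/2) = x by ring] at this
    simp
    field_simp
    nlinarith

lemma K_fourier (x : ℝ) : ∫ t in (-1:ℝ)..1, ((1 - |t| : ℝ) : ℂ) * Complex.exp (Complex.I * (t * x)) = K x := by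
  have hi : ∀ a b : ℝ, IntervalIntegrable (fun t : ℝ => ((1 - |t| : ℝ) : ℂ) * Complex.exp (Complex.I * (t * x))) volume a b := by
    intro a b
    apply Continuous.intervalIntegrable
    fun_prop
  rw [← intervalIntegral.integral_add_adjacent_intervals (hi (-1) 0) (hi 0 1)]
  have h1 := intervalIntegral.integral_comp_neg (a := 0) (b := 1) (fun t : ℝ => ((1 - |t| : ℝ) : ℂ) * Complex.exp (Complex.I * (t * x)))
  rw [neg_zero] at h1
  rw [← h1, ← intervalIntegral.integral_add]
  · have : K x = 2 * (K x / 2) := by ring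
    rw [this, ← K_cos]
    rw [← intervalIntegral.integral_const_mul, ← intervalIntegral.integral_ofReal]
    refine intervalIntegral.integral_congr fun t ht => ?_
    rw [Set.uIcc_of_le zero_le_one] at ht
    rw [abs_neg, abs_of_nonneg ht.1]
    push_cast
    rw [Complex.cos]
    rw [show Complex.I * (-(t:ℂ) * x) = -(t * x) * Complex.I by ring, show Complex.I * ((t:ℂ) * x) = (t * x) * Complex.I by ring]
    ring
  · apply Continuous.intervalIntegrable
    fun_prop
  · exact hi 0 1

lemma conv_eq (B : ℝ → ℝ) (hB : Measurable B) (C : ℝ) (hC : ∀ u, |B u| ≤ C)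
    (g : ℂ → ℂ) (hg : ∀ z : ℂ, 0 < z.re → ∫ u in Set.Ioi (0:ℝ), (B u : ℂ) * Complex.exp (-z * u) = g z)
    (l v σ : ℝ) (hσ : 0 < σ) :
    ∫ u in Set.Ioi (0:ℝ), ((B u * Real.exp (-σ * u) * K (l * (v - u)) : ℝ) : ℂ) =
    ∫ t in Set.Ioc (-1:ℝ) 1, ((1 - |t| : ℝ) : ℂ) * Complex.exp (Complex.I * (t * (l * v))) * g (σ + Complex.I * (l * t)) := by
  have e1 : ∀ u : ℝ, ((B u * Real.exp (-σ * u) * K (l * (v - u)) : ℝ) : ℂ) =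
      ∫ t in Set.Ioc (-1:ℝ) 1, ((B u : ℂ) * Complex.exp (-σ * u)) * (((1 - |t| : ℝ) : ℂ) * Complex.exp (Complex.I * (t * (l * (v - u))))) := by
    intro u
    rw [integral_const_mul, ← intervalIntegral.integral_of_le (by norm_num)]
    have := K_fourier (l * (v - u))
    push_cast at this ⊢
    rw [this]
  simp_rw [e1]
  rw [integral_integral_swap]
  · refine integral_congr_ae (Eventually.of_forall fun t => ?_)
    simp only
    rw [← hg _ (by simpa using hσ), ← integral_const_mul]
    refine integral_congr_ae (Eventually.of_forall fun u => ?_)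
    simp only
    have : Complex.exp (-(σ + Complex.I * (l * t)) * u) * Complex.exp (Complex.I * (t * (l * v))) = 
        Complex.exp (-σ * u) * Complex.exp (Complex.I * (t * (l * (v - u)))) := by
      rw [← Complex.exp_add, ← Complex.exp_add]; congr 1; ring
    linear_combination (-(B u : ℂ) * ((1 - |t| : ℝ) : ℂ)) * this
  · have h1 : IntegrableOn (fun u : ℝ => (B u : ℂ) * Complex.exp (-σ * u)) (Set.Ioi 0) := by
      have h1 : IntegrableOn (fun u : ℝ => Complex.exp (-σ * u)) (Set.Ioi 0) :=
        integrableOn_exp_mul_complex_Ioi (by simpa using hσ) 0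
      refine h1.bdd_mul (c := C) ?_ ?_
      · exact (Complex.measurable_ofReal.comp hB).aestronglyMeasurable
      · exact Eventually.of_forall fun u => by simpa using hC u
    have h2 : IntegrableOn (fun t : ℝ => ((1 - |t| : ℝ) : ℂ)) (Set.Ioc (-1) 1) := by
      apply Continuous.integrableOn_Ioc; fun_prop
    have h3 := Integrable.mul_prod h1 h2
    have h4 := h3.bdd_mul (c := 1) (f := fun p : ℝ × ℝ => Complex.exp (Complex.I * (p.2 * (l * (v - p.1))))) 
      (by apply Continuous.aestronglyMeasurable; fun_prop) (Eventually.of_forall fun p => by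
        rw [show Complex.I * ((p.2:ℂ) * (l * (v - p.1))) = ((p.2 * (l * (v - p.1)) : ℝ) : ℂ) * Complex.I by push_cast; ring]
        rw [Complex.norm_exp_ofReal_mul_I])
    refine h4.congr (Eventually.of_forall fun p => ?_)
    simp only [Function.uncurry]
    ring

lemma K_comp_int (l v : ℝ) (hl : 0 < l) : Integrable (fun u => K (l * (v - u))) := by
  have h := (K_int.comp_mul_left' (R := l) hl.ne').comp_sub_left v
  exact h

lemma conv_eq_zero (B : ℝ → ℝ) (hB : Measurable B) (C : ℝ) (hC : ∀ u, |B u| ≤ C)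
    (g : ℂ → ℂ) (hgc : ContinuousOn g {z | 0 ≤ z.re})
    (hg : ∀ z : ℂ, 0 < z.re → ∫ u in Set.Ioi (0:ℝ), (B u : ℂ) * Complex.exp (-z * u) = g z)
    (l v : ℝ) (hl : 0 < l) :
    ∫ u in Set.Ioi (0:ℝ), ((B u * K (l * (v - u)) : ℝ) : ℂ) =
    ∫ t in Set.Ioc (-1:ℝ) 1, ((1 - |t| : ℝ) : ℂ) * Complex.exp (Complex.I * (t * (l * v))) * g (Complex.I * (l * t)) := by
  have T1 : Tendsto (fun σ : ℝ => ∫ u in Set.Ioi (0:ℝ), ((B u * Real.exp (-σ * u) * K (l * (v - u)) : ℝ) : ℂ)) (𝓝[>] 0)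
      (𝓝 (∫ u in Set.Ioi (0:ℝ), ((B u * K (l * (v - u)) : ℝ) : ℂ))) := by
    refine tendsto_integral_filter_of_dominated_convergence (fun u => C * K (l * (v - u))) ?_ ?_ ?_ ?_
    · refine Eventually.of_forall fun σ => Measurable.aestronglyMeasurable ?_
      have := K_cont.measurable
      fun_prop
    · filter_upwards [self_mem_nhdsWithin] with σ hσ
      filter_upwards [ae_restrict_mem measurableSet_Ioi] with u hu
      rw [Complex.norm_real, norm_mul, norm_mul, Real.norm_of_nonneg (K_nonneg _), Real.norm_of_nonneg (Real.exp_pos _).le]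
      have h1 : Real.exp (-σ * u) ≤ 1 := Real.exp_le_one_iff.2 (by
        have : 0 < σ * u := mul_pos hσ hu
        linarith)
      have h2 := hC u
      rw [Real.norm_eq_abs]
      refine mul_le_mul_of_nonneg_right ?_ (K_nonneg _)
      calc |B u| * Real.exp (-σ * u) ≤ |B u| * 1 := by gcongr
        _ ≤ C := by linarith
    · exact ((K_comp_int l v hl).const_mul C).restrict
    · refine Eventually.of_forall fun u => ?_
      refine tendsto_nhdsWithin_of_tendsto_nhds ?_
      have : Continuous (fun σ : ℝ => ((B u * Real.exp (-σ * u) * K (l * (v - u)) : ℝ) : ℂ)) := by fun_prop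
      simpa using this.tendsto 0
  have T2 : Tendsto (fun σ : ℝ => ∫ t in Set.Ioc (-1:ℝ) 1, ((1 - |t| : ℝ) : ℂ) * Complex.exp (Complex.I * (t * (l * v))) * g (σ + Complex.I * (l * t))) (𝓝[>] 0)
      (𝓝 (∫ t in Set.Ioc (-1:ℝ) 1, ((1 - |t| : ℝ) : ℂ) * Complex.exp (Complex.I * (t * (l * v))) * g (Complex.I * (l * t)))) := by
    have hcomp : IsCompact ((fun p : ℝ × ℝ => (p.1 : ℂ) + Complex.I * (l * p.2)) '' (Set.Icc 0 1 ×ˢ Set.Icc (-1) 1)) := 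
      (isCompact_Icc.prod isCompact_Icc).image (by fun_prop)
    obtain ⟨M, hM⟩ := hcomp.exists_bound_of_continuousOn (hgc.mono (by
      rintro _ ⟨⟨s, t⟩, ⟨hs, ht⟩, rfl⟩
      simpa using hs.1))
    have hM0 : 0 ≤ M := (norm_nonneg _).trans (hM 0 ⟨(0,0), by simp, by simp⟩)
    refine tendsto_integral_filter_of_dominated_convergence (fun u => M) ?_ ?_ ?_ ?_
    · filter_upwards [self_mem_nhdsWithin] with σ hσ
      refine ContinuousOn.aestronglyMeasurable ?_ measurableSet_Ioc
      refine ContinuousOn.mul (Continuous.continuousOn (by fun_prop)) ?_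
      refine hgc.comp (Continuous.continuousOn (by fun_prop)) ?_
      intro t _
      simpa using (le_of_lt hσ)
    · filter_upwards [Ioc_mem_nhdsGT (zero_lt_one)] with σ hσ
      filter_upwards [ae_restrict_mem measurableSet_Ioc] with t ht
      rw [norm_mul, norm_mul, Complex.norm_real]
      rw [show Complex.I * ((t:ℂ) * (l * v)) = ((t * (l * v) : ℝ) : ℂ) * Complex.I by push_cast; ring]
      rw [Complex.norm_exp_ofReal_mul_I, mul_one]
      have h1 : ‖1 - |t|‖ ≤ 1 := by
        have : |t| ≤ 1 := abs_le.2 ⟨ht.1.le, ht.2⟩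
        rw [Real.norm_of_nonneg (by linarith)]; linarith [abs_nonneg t]
      have h2 := hM (σ + Complex.I * (l * t)) ⟨(σ, t), ⟨⟨hσ.1.le, hσ.2⟩, ⟨ht.1.le, ht.2⟩⟩, rfl⟩
      calc _ ≤ 1 * M := mul_le_mul h1 h2 (norm_nonneg _) zero_le_one
        _ = M := one_mul _
    · exact integrable_const M
    · refine Eventually.of_forall fun t => ?_
      refine Tendsto.const_mul _ ?_
      have h0 := hgc (Complex.I * (l * t)) (by simp)
      refine h0.tendsto.comp ?_
      refine tendsto_nhdsWithin_iff.2 ⟨?_, ?_⟩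
      · refine tendsto_nhdsWithin_of_tendsto_nhds ?_
        have : Continuous (fun σ : ℝ => (σ:ℂ) + Complex.I * (l * t)) := by fun_prop
        simpa using this.tendsto 0
      · filter_upwards [self_mem_nhdsWithin] with σ hσ
        simpa using (le_of_lt hσ)
  refine tendsto_nhds_unique (T1.congr' ?_) T2
  filter_upwards [self_mem_nhdsWithin] with σ hσ
  exact conv_eq B hB C hC g hg l v σ hσ

lemma conv_tendsto (B : ℝ → ℝ) (hB : Measurable B) (C : ℝ) (hC : ∀ u, |B u| ≤ C)
    (g : ℂ → ℂ) (hgc : ContinuousOn g {z | 0 ≤ z.re})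
    (hg : ∀ z : ℂ, 0 < z.re → ∫ u in Set.Ioi (0:ℝ), (B u : ℂ) * Complex.exp (-z * u) = g z)
    (l : ℝ) (hl : 0 < l) :
    Tendsto (fun v => ∫ u in Set.Ioi (0:ℝ), B u * K (l * (v - u))) atTop (𝓝 0) := by
  have RL := Real.tendsto_integral_exp_smul_cocompact (Set.indicator (Set.Ioc (-1:ℝ) 1) 
    (fun t => ((1 - |t| : ℝ) : ℂ) * g (Complex.I * (l * t))))
  have hw : Tendsto (fun v : ℝ => (-(l / (2 * Real.pi))) * v) atTop (cocompact ℝ) := by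
    rw [cocompact_eq_atBot_atTop]
    refine Tendsto.mono_right ?_ le_sup_left
    refine tendsto_id.const_mul_atTop_of_neg ?_
    have := Real.pi_pos
    simp; positivity
  have R2 := RL.comp hw
  have e : ∀ v : ℝ, ((∫ u in Set.Ioi (0:ℝ), B u * K (l * (v - u)) : ℝ) : ℂ) = 
     ((fun w : ℝ => ∫ t : ℝ, Real.fourierChar (-(t * w)) • (Set.indicator (Set.Ioc (-1:ℝ) 1) 
    (fun t => ((1 - |t| : ℝ) : ℂ) * g (Complex.I * (l * t)))) t) ∘ (fun v : ℝ => (-(l / (2 * Real.pi))) * v)) v := by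
    intro v
    rw [← integral_complex_ofReal]
    rw [conv_eq_zero B hB C hC g hgc hg l v hl, ← integral_indicator measurableSet_Ioc]
    simp only [Function.comp]
    refine integral_congr_ae (Eventually.of_forall fun t => ?_)
    simp only
    by_cases ht : t ∈ Set.Ioc (-1:ℝ) 1
    · rw [Set.indicator_of_mem ht, Set.indicator_of_mem ht, Circle.smul_def, Real.fourierChar_apply, smul_eq_mul]
      have : (2 * Real.pi * -(t * (-(l / (2 * Real.pi)) * v)) : ℝ) = t * (l * v) := by
        have := Real.pi_pos
        field_simp
      rw [this]
      rw [show Complex.I * ((t:ℂ) * (l * v)) = ((t * (l * v) : ℝ) : ℂ) * Complex.I by push_cast; ring]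
      ring
    · rw [Set.indicator_of_notMem ht, Set.indicator_of_notMem ht]; simp
  have R3 := R2.congr (fun v => (e v).symm)
  exact tendsto_ofReal_iff.1 (by simpa only [Complex.ofReal_zero] using R3)

lemma no_bump (B : ℝ → ℝ) (hB : Measurable B) (C : ℝ) (hC : ∀ u, |B u| ≤ C)
    (hconv : ∀ l : ℝ, 0 < l → Tendsto (fun v => ∫ u in Set.Ioi (0:ℝ), B u * K (l * (v - u))) atTop (𝓝 0))
    (h η : ℝ) (hh : 0 < h) (hη : 0 < η) :
    ∀ᶠ v in atTop, ¬ ∀ u ∈ Set.Icc (v - h) (v + h), η ≤ B u := by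
  have T : Tendsto (fun l : ℝ => (η + C) * (∫ w in (-(l * h))..(l * h), K w) - C * ∫ w, K w) atTop
      (𝓝 ((η + C) * (∫ w, K w) - C * ∫ w, K w)) := by
    refine Tendsto.sub_const (Tendsto.const_mul _ ?_) _
    have : Tendsto (fun l : ℝ => l * h) atTop atTop := tendsto_id.atTop_mul_const hh
    exact intervalIntegral_tendsto_integral K_int (tendsto_neg_atTop_atBot.comp this) this
  have hp : 0 < (η + C) * (∫ w, K w) - C * ∫ w, K w := by
    have := mul_pos hη K_int_pos
    linarith
  obtain ⟨l, hl, hl0⟩ := ((T.eventually (lt_mem_nhds hp)).and (eventually_gt_atTop 0)).exists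
  set P := (η + C) * (∫ w in (-(l * h))..(l * h), K w) - C * ∫ w, K w with hP
  have hc := (hconv l hl0).eventually (gt_mem_nhds (show 0 < l⁻¹ * P by positivity))
  filter_upwards [hc, eventually_gt_atTop h] with v hv hvh hall
  refine absurd hv (not_lt.2 ?_)
  have hKi := K_comp_int l v hl0
  have I1 : ∫ u, K (l * (v - u)) = l⁻¹ * ∫ w, K w := by
    rw [integral_sub_left_eq_self (fun u => K (l * u)) volume v, Measure.integral_comp_mul_left]
    simp [abs_of_pos (inv_pos.2 hl0)]
  have I2 : ∫ u in Set.Icc (v - h) (v + h), K (l * (v - u)) = l⁻¹ * ∫ w in (-(l * h))..(l * h), K w := by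
    rw [integral_Icc_eq_integral_Ioc, ← intervalIntegral.integral_of_le (by linarith)]
    rw [intervalIntegral.integral_comp_sub_left (fun u => K (l * u)) v]
    rw [intervalIntegral.integral_comp_mul_left _ hl0.ne']
    rw [smul_eq_mul]
    congr 2 <;> ring
  have I3 : l⁻¹ * P = ∫ u, ((η + C) * (Set.Icc (v - h) (v + h)).indicator (fun u => K (l * (v - u))) u - C * K (l * (v - u))) := by
    rw [integral_sub, integral_const_mul, integral_const_mul, integral_indicator measurableSet_Icc, I1, I2, hP]
    · ring
    · exact (hKi.indicator measurableSet_Icc).const_mul _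
    · exact hKi.const_mul _
  rw [I3, ← integral_indicator measurableSet_Ioi]
  have hC0 : 0 ≤ C := (abs_nonneg _).trans (hC 0)
  refine integral_mono ?_ ?_ ?_
  · exact ((hKi.indicator measurableSet_Icc).const_mul _).sub (hKi.const_mul _)
  · refine IntegrableOn.integrable_indicator ?_ measurableSet_Ioi
    refine (hKi.restrict).bdd_mul (c := C) hB.aestronglyMeasurable ?_
    exact Eventually.of_forall hC
  · intro u
    simp only
    have hk := K_nonneg (l * (v - u))
    by_cases hu : u ∈ Set.Icc (v - h) (v + h)
    · have hu0 : u ∈ Set.Ioi (0:ℝ) := by simp only [Set.mem_Ioi]; linarith [hu.1]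
      rw [Set.indicator_of_mem hu, Set.indicator_of_mem hu0]
      nlinarith [hall u hu]
    · rw [Set.indicator_of_notMem hu]
      by_cases hu0 : u ∈ Set.Ioi (0:ℝ)
      · rw [Set.indicator_of_mem hu0]
        nlinarith [(abs_le.1 (hC u)).1]
      · rw [Set.indicator_of_notMem hu0]
        nlinarith

end WP
end Part2

section Part3
open Filter Topology MeasureTheory Chebyshev
namespace WP

lemma A_conv (l : ℝ) (hl : 0 < l) :
    Tendsto (fun v => ∫ u in Set.Ioi (0:ℝ), (A u - 1) * K (l * (v - u))) atTop (𝓝 0) := by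
  obtain ⟨F, hFc, hF⟩ := exists_F
  refine conv_tendsto (fun u => A u - 1) (A_meas.sub_const 1) 7 ?_ (fun z => (F (1 + z) - 1) / (1 + z)) ?_ ?_ l hl
  · intro u
    have := A_nonneg u
    have := A_le u
    rw [abs_le]; constructor <;> linarith
  · refine ContinuousOn.div (ContinuousOn.sub (hFc.comp (by fun_prop) ?_) continuousOn_const) (by fun_prop) ?_
    · intro z hz; simpa using hz
    · intro z hz h
      have := congrArg Complex.re h
      simp at this hz
      linarith
  · exact laplace F hF

lemma A_tendsto : Tendsto A atTop (𝓝 1) := by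
  have hup : ∀ η : ℝ, 0 < η → ∀ᶠ u in atTop, A u ≤ 1 + η := by
    intro η hη
    set h := Real.log ((1 + η) / (1 + η / 2)) / 2 with hh
    have hq : 1 < (1 + η) / (1 + η / 2) := by rw [lt_div_iff₀ (by positivity)]; linarith
    have hpos : 0 < h := by have := Real.log_pos hq; positivity
    have hexp : Real.exp (-(2 * h)) * (1 + η) = 1 + η / 2 := by
      rw [hh, mul_div_cancel₀ _ two_ne_zero, Real.exp_neg, Real.exp_log (by positivity)]
      field_simp
    have nb := no_bump (fun u => A u - 1) (A_meas.sub_const 1) 7 (by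
      intro u
      have := A_nonneg u
      have := A_le u
      rw [abs_le]; constructor <;> linarith) A_conv h (η / 2) hpos (by positivity)
    have nb2 := (tendsto_atTop_add_const_right atTop h tendsto_id).eventually nb
    filter_upwards [nb2] with u hu
    by_contra hcon
    push Not at hcon
    apply hu
    intro w hw
    simp only [id] at hw
    have h1 := A_slow u (w - u) (by linarith [hw.1])
    rw [add_sub_cancel] at h1
    have h2 : Real.exp (-(2 * h)) ≤ Real.exp (-(w - u)) := Real.exp_le_exp.2 (by linarith [hw.2])
    have h3 : Real.exp (-(2 * h)) * (1 + η) ≤ Real.exp (-(w - u)) * A u := by gcongr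
    linarith
  have hlow : ∀ η : ℝ, 0 < η → η < 1 → ∀ᶠ u in atTop, 1 - η ≤ A u := by
    intro η hη hη1
    have h1η : 0 < 1 - η := by linarith
    set h := Real.log ((1 - η / 2) / (1 - η)) / 2 with hh
    have hq : 1 < (1 - η / 2) / (1 - η) := by rw [lt_div_iff₀ h1η]; linarith
    have hpos : 0 < h := by have := Real.log_pos hq; positivity
    have hexp : Real.exp (2 * h) * (1 - η) = 1 - η / 2 := by
      rw [hh, mul_div_cancel₀ _ two_ne_zero, Real.exp_log (by linarith)]
      field_simp
    have nb := no_bump (fun u => 1 - A u) (A_meas.const_sub 1) 7 (by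
      intro u
      have := A_nonneg u
      have := A_le u
      rw [abs_le]; constructor <;> linarith) (by
        intro l hl
        have := (A_conv l hl).neg
        rw [neg_zero] at this
        refine this.congr fun v => ?_
        rw [← integral_neg]
        congr 1; ext u; ring) h (η / 2) hpos (by positivity)
    have nb2 := (tendsto_atTop_add_const_right atTop (-h) tendsto_id).eventually nb
    filter_upwards [nb2] with u hu
    by_contra hcon
    push Not at hcon
    apply hu
    intro w hw
    simp only [id] at hw
    have h1 := A_slow w (u - w) (by linarith [hw.2])
    rw [add_sub_cancel] at h1
    have h2 : Real.exp (u - w) ≤ Real.exp (2 * h) := Real.exp_le_exp.2 (by linarith [hw.1])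
    have h4 : A w ≤ Real.exp (u - w) * A u := by
      have := mul_le_mul_of_nonneg_left h1 (Real.exp_pos (u - w)).le
      rwa [← mul_assoc, ← Real.exp_add, add_neg_cancel, Real.exp_zero, one_mul] at this
    have h3 : Real.exp (u - w) * A u ≤ Real.exp (2 * h) * (1 - η) := by
      have := A_nonneg u
      gcongr
    linarith
  rw [Metric.tendsto_nhds]
  intro ε hε
  have hm : 0 < min (ε / 2) (1 / 2) := by positivity
  filter_upwards [hup _ hm, hlow _ hm (by linarith [min_le_right (ε / 2) (1 / 2 : ℝ)])] with u h1 h2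
  have := min_le_left (ε / 2) (1 / 2 : ℝ)
  rw [Real.dist_eq, abs_lt]
  constructor <;> linarith

lemma psi_tendsto : Tendsto (fun x => ψ x / x) atTop (𝓝 1) := by
  refine (A_tendsto.comp Real.tendsto_log_atTop).congr' ?_
  filter_upwards [eventually_gt_atTop 0] with x hx
  simp [A, Real.exp_log hx, Real.exp_neg, div_eq_mul_inv]

lemma theta_tendsto : Tendsto (fun x => θ x / x) atTop (𝓝 1) := by
  have h1 : Tendsto (fun x => (ψ - θ) x / x) atTop (𝓝 0) := by
    refine (isBigO_psi_sub_theta_sqrt.trans_isLittleO (k := fun x => x) ?_).tendsto_div_nhds_zero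
    refine Asymptotics.isLittleO_iff_tendsto' ?_ |>.mpr ?_
    · filter_upwards [eventually_gt_atTop 0] with x hx h
      exact absurd h hx.ne'
    · refine (tendsto_inv_atTop_zero.comp Real.tendsto_sqrt_atTop).congr' ?_
      filter_upwards [eventually_gt_atTop 0] with x hx
      simp only [Function.comp]
      rw [Real.sqrt_div_self', one_div]
  have := psi_tendsto.sub h1
  rw [sub_zero] at this
  refine this.congr fun x => ?_
  simp only [Pi.sub_apply]
  ring

theorem pnt : Tendsto (fun x : ℝ => (Nat.primeCounting ⌊x⌋₊ : ℝ) * Real.log x / x) atTop (𝓝 1) := by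
  have h1 : Tendsto (fun x : ℝ => ((Nat.primeCounting ⌊x⌋₊ : ℝ) - θ x / Real.log x) / (x / Real.log x)) atTop (𝓝 0) := by
    refine (primeCounting_sub_theta_div_log_isBigO.trans_isLittleO ?_).tendsto_div_nhds_zero
    refine Asymptotics.isLittleO_iff_tendsto' ?_ |>.mpr ?_
    · filter_upwards [eventually_gt_atTop 1] with x hx h
      have := Real.log_pos hx
      have : x / Real.log x ≠ 0 := by positivity
      exact absurd h this
    · refine (tendsto_inv_atTop_zero.comp Real.tendsto_log_atTop).congr' ?_
      filter_upwards [eventually_gt_atTop 1] with x hx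
      have := Real.log_pos hx
      simp only [Function.comp]
      field_simp
  have := h1.add theta_tendsto
  rw [zero_add] at this
  refine this.congr' ?_
  filter_upwards [eventually_gt_atTop 1] with x hx
  have := Real.log_pos hx
  field_simp
  ring

end WP
end Part3

section Part4
open Filter Topology
namespace WP

/-- sum of divisors -/
abbrev sg (n : ℕ) : ℕ := ArithmeticFunction.sigma 1 n

lemma sg_mul {m n : ℕ} (h : Nat.Coprime m n) : sg (m * n) = sg m * sg n :=
  ArithmeticFunction.isMultiplicative_sigma.map_mul_of_coprime h

lemma sg_pos {n : ℕ} (hn : 0 < n) : 0 < sg n := by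
  unfold sg; rw [ArithmeticFunction.sigma_one_apply]
  exact Finset.sum_pos (fun d hd => Nat.pos_of_mem_divisors hd) ⟨1, by simp; omega⟩

lemma le_sg {n : ℕ} (hn : 0 < n) : n ≤ sg n := by
  unfold sg; rw [ArithmeticFunction.sigma_one_apply]
  exact Finset.single_le_sum (f := fun d => d) (fun _ _ => Nat.zero_le _) (Nat.mem_divisors_self n hn.ne')

lemma coprime_sg_pow {p : ℕ} (hp : p.Prime) (e : ℕ) : Nat.Coprime (p ^ e) (sg (p ^ e)) := by
  apply Nat.Coprime.pow_left
  rw [hp.coprime_iff_not_dvd]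
  unfold sg
  rw [ArithmeticFunction.sigma_one_apply_prime_pow hp, Finset.sum_range_succ']
  intro h
  have : p ∣ ∑ k ∈ Finset.range e, p ^ (k + 1) := Finset.dvd_sum fun k _ => dvd_pow_self p (by omega)
  have := (Nat.dvd_add_right this).1 h
  simp at this
  exact hp.one_lt.ne' this

/-- perfect numbers up to N -/
noncomputable def perfSet (a b N : ℕ) : Finset ℕ := by
  classical exact (Finset.Icc 1 N).filter (fun m => b * sg m = a * m)

lemma mem_perfSet {a b N m : ℕ} : m ∈ perfSet a b N ↔ (1 ≤ m ∧ m ≤ N) ∧ b * sg m = a * m := by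
  classical
  simp [perfSet]

/-- the component at p -/
abbrev cmp (n p : ℕ) : ℕ := p ^ n.factorization p

lemma card_big (a b N : ℕ) (ha : 0 < a) (hb : 0 < b) (Q : ℝ) (hQ : 0 < Q) (S : Finset ℕ) (hS : S ⊆ perfSet a b N)
    (hbig : ∀ n ∈ S, ∃ p, p.Prime ∧ Q < cmp n p) : (S.card : ℝ) ≤ N / Q := by
  classical
  choose! pr hpr using hbig
  have hinj : Set.InjOn (fun n => n / cmp n (pr n)) S := by
    intro n hn n' hn' h
    simp only at h
    obtain ⟨⟨h1, h2⟩, h3⟩ := mem_perfSet.1 (hS hn)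
    obtain ⟨⟨h1', h2'⟩, h3'⟩ := mem_perfSet.1 (hS hn')
    have hp := (hpr n hn).1
    have hp' := (hpr n' hn').1
    set q := cmp n (pr n)
    set q' := cmp n' (pr n')
    set m := n / q with hm
    have e1 : q * m = n := Nat.ordProj_mul_ordCompl_eq_self n (pr n)
    have e2 : q' * m = n' := by rw [h]; exact Nat.ordProj_mul_ordCompl_eq_self n' (pr n')
    have c1 : Nat.Coprime q m := (Nat.coprime_ordCompl hp (by omega)).pow_left _
    have c2 : Nat.Coprime q' m := by rw [h]; exact (Nat.coprime_ordCompl hp' (by omega)).pow_left _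
    rw [← e1, sg_mul c1] at h3
    rw [← e2, sg_mul c2] at h3'
    have hm0 : 0 < m := Nat.pos_of_ne_zero (by rintro h; rw [h] at e1; omega)
    have key : sg q * q' = sg q' * q := by
      have hpos : 0 < b * sg m * (a * m) := by have := sg_pos hm0; positivity
      have : (b * sg m * (a * m)) * (sg q * q') = (b * sg m * (a * m)) * (sg q' * q) := by
        calc _ = (b * (sg q * sg m)) * (a * (q' * m)) := by ring
          _ = (b * (sg q' * sg m)) * (a * (q * m)) := by rw [h3, h3']; ring
          _ = _ := by ring
      exact Nat.eq_of_mul_eq_mul_left hpos this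
    have d1 : q ∣ q' := (coprime_sg_pow hp _).dvd_of_dvd_mul_left ⟨sg q', by rw [key]; ring⟩
    have d2 : q' ∣ q := (coprime_sg_pow hp' _).dvd_of_dvd_mul_left ⟨sg q, by rw [← key]; ring⟩
    rw [← e1, ← e2, Nat.dvd_antisymm d1 d2]
  have hcard : S.card ≤ (Finset.Icc 1 ⌊(N:ℝ) / Q⌋₊).card := by
    refine Finset.card_le_card_of_injOn _ ?_ hinj
    intro n hn
    obtain ⟨⟨h1, h2⟩, h3⟩ := mem_perfSet.1 (hS hn)
    have e1 : cmp n (pr n) * (n / cmp n (pr n)) = n := Nat.ordProj_mul_ordCompl_eq_self n (pr n)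
    have hm0 : 0 < n / cmp n (pr n) := Nat.pos_of_ne_zero (by rintro h; rw [h] at e1; omega)
    simp only [Finset.coe_Icc, Set.mem_Icc]
    refine ⟨hm0, Nat.le_floor ?_⟩
    rw [le_div_iff₀ hQ]
    have : ((cmp n (pr n) : ℕ) : ℝ) * ((n / cmp n (pr n) : ℕ) : ℝ) = n := by exact_mod_cast e1
    have hN : (n:ℝ) ≤ N := by exact_mod_cast h2
    have hq := (hpr n hn).2
    have hm0' : (0:ℝ) < ((n / cmp n (pr n) : ℕ) : ℝ) := by exact_mod_cast hm0
    nlinarith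
  calc (S.card : ℝ) ≤ ((Finset.Icc 1 ⌊(N:ℝ) / Q⌋₊).card : ℝ) := by exact_mod_cast hcard
    _ = (⌊(N:ℝ) / Q⌋₊ : ℝ) := by simp
    _ ≤ N / Q := Nat.floor_le (by positivity)

lemma sum_inv_sqrt (M : ℕ) : ∑ j ∈ Finset.Icc 1 M, (Real.sqrt j)⁻¹ ≤ 2 * Real.sqrt M := by
  induction M with
  | zero => simp
  | succ M ih =>
    rw [Finset.sum_Icc_succ_top (by omega)]
    have h1 : 0 < Real.sqrt ((M + 1 : ℕ) : ℝ) := Real.sqrt_pos.2 (by positivity)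
    have h2 : Real.sqrt ((M + 1 : ℕ) : ℝ) ^ 2 = M + 1 := by rw [Real.sq_sqrt (by positivity)]; push_cast; ring
    have h3 : Real.sqrt (M : ℝ) ^ 2 = M := Real.sq_sqrt (by positivity)
    have h4 : 0 ≤ Real.sqrt (M : ℝ) := Real.sqrt_nonneg _
    have : (Real.sqrt ((M + 1 : ℕ) : ℝ))⁻¹ ≤ 2 * Real.sqrt ((M + 1 : ℕ) : ℝ) - 2 * Real.sqrt (M:ℝ) := by
      rw [inv_le_iff_one_le_mul₀ h1]
      nlinarith [sq_nonneg (Real.sqrt ((M + 1 : ℕ) : ℝ) - Real.sqrt (M:ℝ))]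
    linarith

lemma cmp_injOn (n : ℕ) : Set.InjOn (cmp n) n.primeFactors := by
  intro p hp p' hp' h
  have h1 := Nat.mem_primeFactors.1 hp
  have h2 := Nat.mem_primeFactors.1 hp'
  have : n.factorization p ≠ 0 := (h1.1.factorization_pos_of_dvd h1.2.2 h1.2.1).ne'
  have d : p ∣ cmp n p' := by rw [← h]; exact dvd_pow_self p this
  exact (Nat.prime_dvd_prime_iff_eq h1.1 h2.1).1 (h1.1.dvd_of_dvd_pow d)

lemma card_smooth (N : ℕ) (Q : ℝ) (S : Finset ℕ) (hS : S ⊆ Finset.Icc 1 N)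
    (hsm : ∀ n ∈ S, ∀ p, p.Prime → (cmp n p : ℝ) ≤ Q) (hQ : 0 ≤ Q) :
    (S.card : ℝ) ≤ Real.sqrt N * Real.exp (2 * Real.sqrt Q) := by
  classical
  set J := Finset.Icc 1 ⌊Q⌋₊ with hJ
  let f : ℕ → Finset ℕ := fun n => n.primeFactors.image (cmp n)
  have hprod : ∀ n ∈ S, ∏ j ∈ f n, j = n := by
    intro n hn
    have h1 := Finset.mem_Icc.1 (hS hn)
    simp only [f]
    rw [Finset.prod_image (cmp_injOn n)]
    exact Nat.prod_factorization_pow_eq_self (by omega)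
  have hsub : ∀ n ∈ S, f n ∈ J.powerset := by
    intro n hn
    rw [Finset.mem_powerset]
    intro q hq
    obtain ⟨p, hp, rfl⟩ := Finset.mem_image.1 hq
    have hp' := (Nat.mem_primeFactors.1 hp).1
    rw [hJ, Finset.mem_Icc]
    exact ⟨Nat.pos_of_ne_zero (pow_ne_zero _ hp'.ne_zero), Nat.le_floor (hsm n hn p hp')⟩
  have hinj : Set.InjOn f S := by
    intro n hn n' hn' h
    rw [← hprod n hn, ← hprod n' hn', h]
  have h1 : (S.card : ℝ) ≤ ∑ n ∈ S, Real.sqrt N * ∏ j ∈ f n, (Real.sqrt j)⁻¹ := by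
    rw [Finset.card_eq_sum_ones]
    push_cast
    refine Finset.sum_le_sum fun n hn => ?_
    have hn1 := Finset.mem_Icc.1 (hS hn)
    have : ∏ j ∈ f n, (Real.sqrt j)⁻¹ = (Real.sqrt n)⁻¹ := by
      rw [Finset.prod_inv_distrib, ← Real.sqrt_prod _ (fun _ _ => Nat.cast_nonneg _)]
      conv_rhs => rw [← hprod n hn]
      push_cast; rfl
    rw [this, ← div_eq_mul_inv, one_le_div (Real.sqrt_pos.2 (by exact_mod_cast hn1.1))]
    exact Real.sqrt_le_sqrt (by exact_mod_cast hn1.2)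
  refine h1.trans ?_
  rw [← Finset.mul_sum]
  refine mul_le_mul_of_nonneg_left ?_ (Real.sqrt_nonneg _)
  calc ∑ n ∈ S, ∏ j ∈ f n, (Real.sqrt j)⁻¹ = ∑ t ∈ S.image f, ∏ j ∈ t, (Real.sqrt j)⁻¹ := by
        rw [Finset.sum_image hinj]
    _ ≤ ∑ t ∈ J.powerset, ∏ j ∈ t, (Real.sqrt j)⁻¹ := by
        refine Finset.sum_le_sum_of_subset_of_nonneg ?_ ?_
        · intro t ht
          obtain ⟨n, hn, rfl⟩ := Finset.mem_image.1 ht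
          exact hsub n hn
        · intro t _ _
          exact Finset.prod_nonneg fun j _ => inv_nonneg.2 (Real.sqrt_nonneg _)
    _ = ∏ j ∈ J, (1 + (Real.sqrt j)⁻¹) := by rw [Finset.prod_one_add]
    _ ≤ ∏ j ∈ J, Real.exp ((Real.sqrt j)⁻¹) := by
        refine Finset.prod_le_prod (fun j _ => by positivity) fun j _ => ?_
        rw [add_comm]; exact Real.add_one_le_exp _
    _ = Real.exp (∑ j ∈ J, (Real.sqrt j)⁻¹) := by rw [Real.exp_sum]
    _ ≤ Real.exp (2 * Real.sqrt Q) := by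
        apply Real.exp_le_exp.2
        refine (sum_inv_sqrt _).trans ?_
        have := Nat.floor_le hQ
        gcongr

lemma card_perf (a b N : ℕ) (ha : 0 < a) (hb : 0 < b) (Q : ℝ) (hQ : 0 < Q) :
    ((perfSet a b N).card : ℝ) ≤ N / Q + Real.sqrt N * Real.exp (2 * Real.sqrt Q) := by
  classical
  rw [← Finset.card_filter_add_card_filter_not (s := perfSet a b N) (fun n => ∃ p, p.Prime ∧ Q < cmp n p)]
  rw [Nat.cast_add]
  refine add_le_add ?_ ?_
  · exact card_big a b N ha hb Q hQ _ (Finset.filter_subset _ _) fun n hn => (Finset.mem_filter.1 hn).2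
  · refine card_smooth N Q _ ?_ ?_ hQ.le
    · intro n hn
      have := mem_perfSet.1 (Finset.mem_filter.1 hn).1
      exact Finset.mem_Icc.2 this.1
    · intro n hn p hp
      have := (Finset.mem_filter.1 hn).2
      push Not at this
      exact this p hp

end WP
end Part4

section Part5
open Filter Topology
namespace WP

lemma sqrt_Q_le {L : ℝ} (hL : 4096 ≤ L) : 2 * Real.sqrt (L * Real.sqrt L) ≤ L / 4 := by
  have h1 : (64:ℝ) ≤ Real.sqrt L := Real.le_sqrt_of_sq_le (by norm_num; linarith)
  have h2 : Real.sqrt L ^ 2 = L := Real.sq_sqrt (by linarith)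
  have : Real.sqrt (L * Real.sqrt L) ≤ L / 8 := by
    apply Real.sqrt_le_iff.2
    refine ⟨by linarith, ?_⟩
    set r := Real.sqrt L
    rw [← h2]
    have : 0 ≤ r ^ 3 * (r - 64) := by
      have : 0 ≤ r - 64 := by linarith
      positivity
    nlinarith
  linarith

/-- the weight -/
noncomputable def fw (a b : ℕ) (m : ℕ) : ℝ := by
  classical exact if 0 < m ∧ b * sg m = a * m then 1 / (m:ℝ) else 0

lemma fw_nonneg (a b m : ℕ) : 0 ≤ fw a b m := by
  unfold fw; split_ifs <;> positivity

lemma block_le (a b k : ℕ) : ∑ m ∈ Finset.Ico (2 ^ k) (2 ^ (k + 1)), fw a b m ≤ (perfSet a b (2 ^ (k + 1))).card / 2 ^ k := by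
  classical
  have h1 : ∑ m ∈ Finset.Ico (2 ^ k) (2 ^ (k + 1)), fw a b m ≤ 
      ∑ m ∈ Finset.Ico (2 ^ k) (2 ^ (k + 1)), if m ∈ perfSet a b (2 ^ (k + 1)) then (1 / 2 ^ k : ℝ) else 0 := by
    refine Finset.sum_le_sum fun m hm => ?_
    rw [Finset.mem_Ico] at hm
    unfold fw
    by_cases h : 0 < m ∧ b * sg m = a * m
    · rw [if_pos h, if_pos (mem_perfSet.2 ⟨⟨h.1, hm.2.le⟩, h.2⟩)]
      apply one_div_le_one_div_of_le (by positivity)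
      exact_mod_cast hm.1
    · rw [if_neg h]; split_ifs <;> positivity
  refine h1.trans ?_
  rw [← Finset.sum_filter, Finset.sum_const, nsmul_eq_mul, mul_one_div]
  gcongr
  intro m hm
  exact (Finset.mem_filter.1 hm).2

lemma summable_c : Summable (fun k : ℕ => 2 * (((k + 1 : ℕ) : ℝ) ^ (3/2 : ℝ))⁻¹ + 
    2 * Real.exp (2 * Real.sqrt (((k + 1 : ℕ) : ℝ) * Real.sqrt ((k + 1 : ℕ) : ℝ)) - (k + 1 : ℕ) * (Real.log 2 / 2))) := by
  refine Summable.add (Summable.mul_left _ ?_) (Summable.mul_left _ ?_)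
  · exact (summable_nat_add_iff 1 (f := fun k : ℕ => ((k : ℝ) ^ (3/2 : ℝ))⁻¹)).2 (Real.summable_nat_rpow_inv.2 (by norm_num))
  · refine (summable_nat_add_iff 1 (f := fun k : ℕ => Real.exp (2 * Real.sqrt ((k : ℝ) * Real.sqrt (k : ℝ)) - k * (Real.log 2 / 2)))).2 ?_
    refine Summable.of_norm_bounded_eventually_nat (g := fun k : ℕ => Real.exp (k * (-(1/20)))) ?_ ?_
    · exact Real.summable_exp_nat_mul_iff.2 (by norm_num)
    · filter_upwards [eventually_ge_atTop 4096] with k hk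
      rw [Real.norm_of_nonneg (Real.exp_pos _).le]
      apply Real.exp_le_exp.2
      have hk' : (4096:ℝ) ≤ k := by exact_mod_cast hk
      have := sqrt_Q_le hk'
      have := Real.log_two_gt_d9
      nlinarith

lemma fw_summable (a b : ℕ) (ha : 0 < a) (hb : 0 < b) : Summable (fw a b) := by
  have hblock : ∀ k : ℕ, ∑ m ∈ Finset.Ico (2 ^ k) (2 ^ (k + 1)), fw a b m ≤ 2 * (((k + 1 : ℕ) : ℝ) ^ (3/2 : ℝ))⁻¹ + 
    2 * Real.exp (2 * Real.sqrt (((k + 1 : ℕ) : ℝ) * Real.sqrt ((k + 1 : ℕ) : ℝ)) - (k + 1 : ℕ) * (Real.log 2 / 2)) := by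
    intro k
    refine (block_le a b k).trans ?_
    set L : ℝ := ((k + 1 : ℕ) : ℝ) with hL
    have hLp : 0 < L := by rw [hL]; positivity
    have := card_perf a b (2 ^ (k + 1)) ha hb (L * Real.sqrt L) (by positivity)
    rw [div_le_iff₀ (by positivity)]
    refine this.trans (le_of_eq ?_)
    have e1 : L ^ (3/2 : ℝ) = L * Real.sqrt L := by
      rw [Real.sqrt_eq_rpow, show (3/2:ℝ) = 1 + 1/2 by norm_num, Real.rpow_add hLp, Real.rpow_one]
    have e3 : Real.exp (L * (Real.log 2 / 2)) ^ 2 = 2 ^ (k+1) := by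
      rw [← Real.exp_nat_mul, show ((2:ℕ):ℝ) * (L * (Real.log 2 / 2)) = ((k+1:ℕ):ℝ) * Real.log 2 by rw [hL]; push_cast; ring, Real.exp_nat_mul, Real.exp_log two_pos]
    have e2 : Real.sqrt ((2 ^ (k+1) : ℕ) : ℝ) = Real.exp (L * (Real.log 2 / 2)) := by
      push_cast
      rw [← e3, Real.sqrt_sq (Real.exp_pos _).le]
    rw [e1, e2, Real.exp_sub, add_mul]
    have hp : (2:ℝ) * 2 ^ k = 2 ^ (k+1) := by ring
    have hE := Real.exp_pos (L * (Real.log 2 / 2))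
    congr 1
    · push_cast; rw [← hp]; field_simp
    · have : 2 * (Real.exp (2 * √(L * √L)) / Real.exp (L * (Real.log 2 / 2))) * 2 ^ k = 
        (Real.exp (2 * √(L * √L)) / Real.exp (L * (Real.log 2 / 2))) * (2 * 2 ^ k) := by ring
      rw [this, hp, ← e3]
      field_simp
  have hsum : ∀ M : ℕ, ∑ m ∈ Finset.range (2 ^ M), fw a b m ≤ ∑ k ∈ Finset.range M, (2 * (((k + 1 : ℕ) : ℝ) ^ (3/2 : ℝ))⁻¹ + 
    2 * Real.exp (2 * Real.sqrt (((k + 1 : ℕ) : ℝ) * Real.sqrt ((k + 1 : ℕ) : ℝ)) - (k + 1 : ℕ) * (Real.log 2 / 2))) := by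
    intro M
    induction M with
    | zero => simp [fw]
    | succ M ih =>
      rw [Finset.sum_range_succ, ← Finset.sum_range_add_sum_Ico _ (show 2 ^ M ≤ 2 ^ (M+1) from Nat.pow_le_pow_right (by norm_num) (by omega))]
      exact add_le_add ih (hblock M)
  refine summable_of_sum_range_le (c := ∑' k : ℕ, (2 * (((k + 1 : ℕ) : ℝ) ^ (3/2 : ℝ))⁻¹ + 
    2 * Real.exp (2 * Real.sqrt (((k + 1 : ℕ) : ℝ) * Real.sqrt ((k + 1 : ℕ) : ℝ)) - (k + 1 : ℕ) * (Real.log 2 / 2)))) (fw_nonneg a b) ?_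
  intro n
  calc ∑ m ∈ Finset.range n, fw a b m ≤ ∑ m ∈ Finset.range (2 ^ n), fw a b m := by
        refine Finset.sum_le_sum_of_subset_of_nonneg ?_ (fun m _ _ => fw_nonneg a b m)
        exact Finset.range_mono Nat.lt_two_pow_self.le
    _ ≤ _ := hsum n
    _ ≤ _ := summable_c.sum_le_tsum _ (fun k _ => by positivity)

lemma perf_small (a b : ℕ) (ha : 0 < a) (hb : 0 < b) :
    Tendsto (fun x : ℝ => ((perfSet a b ⌊x⌋₊).card : ℝ) / (x / Real.log x)) atTop (𝓝 0) := by
  have hup : Tendsto (fun L : ℝ => (Real.sqrt L)⁻¹ + L * Real.exp (-(1/4) * L)) atTop (𝓝 (0 + 0)) := by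
    refine Tendsto.add (tendsto_inv_atTop_zero.comp Real.tendsto_sqrt_atTop) ?_
    have := tendsto_rpow_mul_exp_neg_mul_atTop_nhds_zero 1 (1/4) (by norm_num)
    simpa using this
  rw [add_zero] at hup
  refine squeeze_zero' ?_ ?_ (hup.comp Real.tendsto_log_atTop)
  · filter_upwards [eventually_gt_atTop 1] with x hx
    have := Real.log_pos hx
    positivity
  · filter_upwards [eventually_gt_atTop 1, Real.tendsto_log_atTop.eventually_ge_atTop 4096] with x hx hL
    have hLp := Real.log_pos hx
    have hx0 : 0 < x := by linarith
    simp only [Function.comp]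
    set L := Real.log x with hLdef
    have hs : 0 < Real.sqrt L := Real.sqrt_pos.2 hLp
    have := card_perf a b ⌊x⌋₊ ha hb (L * Real.sqrt L) (by positivity)
    have hfl := Nat.floor_le hx0.le
    have hsq : Real.sqrt x = Real.exp (L / 2) := by
      rw [show x = Real.exp (L/2) ^ 2 by rw [← Real.exp_nat_mul, show ((2:ℕ):ℝ) * (L/2) = L by push_cast; ring, hLdef, Real.exp_log hx0], Real.sqrt_sq (Real.exp_pos _).le]
    have h2 : ((perfSet a b ⌊x⌋₊).card : ℝ) ≤ x / (L * Real.sqrt L) + x * Real.exp (-(1/4) * L) := by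
      refine this.trans (add_le_add (by gcongr) ?_)
      calc Real.sqrt ⌊x⌋₊ * Real.exp (2 * √(L * √L)) ≤ Real.sqrt x * Real.exp (L / 4) := by
            have := sqrt_Q_le hL
            gcongr
        _ = Real.exp (L/2 + L/4) := by rw [hsq, Real.exp_add]
        _ = Real.exp L * Real.exp (-(1/4) * L) := by rw [← Real.exp_add]; congr 1; ring
        _ = _ := by rw [hLdef, Real.exp_log hx0]
    rw [div_le_iff₀ (by positivity)]
    refine h2.trans (le_of_eq ?_)
    field_simp

end WP
end Part5

section Part6
open Filter Topology
namespace WP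

lemma count_u (a b u N T : ℕ) (ha : 0 < a) (hb : 0 < b) (hu : 0 < u) (S : Finset ℕ)
    (hS : ∀ v ∈ S, u * v ≤ N ∧ (b * sg u * sg v : ℤ) - a * u * v ≠ 0 ∧
      |(b * sg u * sg v : ℤ) - a * u * v| ≤ T) :
    (S.card : ℝ) ≤ 2 * T * (N / (u:ℝ) ^ 2) + 2 * T := by
  classical
  have hsu : 0 < sg u := sg_pos hu
  obtain ⟨g, M, A, hg, hcop, hM, hA⟩ := Nat.exists_coprime' (m := b * sg u) (n := a * u) (Nat.gcd_pos_of_pos_left _ (by positivity))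
  have hMpos : 0 < M := Nat.pos_of_ne_zero (by rintro rfl; simp at hM; omega)
  have huM : u ≤ M * g := by
    rw [← hM]; exact (le_sg hu).trans (Nat.le_mul_of_pos_left _ hb)
  let D : ℕ → ℤ := fun v => M * sg v - A * v
  have hD : ∀ v, (b * sg u * sg v : ℤ) - a * u * v = g * D v := by
    intro v
    have h1 : (b * sg u : ℤ) = M * g := by exact_mod_cast hM
    have h2 : (a * u : ℤ) = A * g := by exact_mod_cast hA
    simp only [D]; rw [h1, h2]; ring
  have hcard : S.card ≤ (((Finset.Icc (-((T / g : ℕ) : ℤ)) ((T / g : ℕ) : ℤ)).erase 0) ×ˢ Finset.range (N / u / M + 1)).card := by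
    refine Finset.card_le_card_of_injOn (fun v => (D v, v / M)) ?_ ?_
    · intro v hv
      obtain ⟨h1, h2, h3⟩ := hS v hv
      rw [hD] at h2 h3
      simp only [Finset.coe_product, Set.mem_prod, Finset.mem_coe, Finset.mem_erase, Finset.mem_Icc, Finset.mem_range]
      have h4 : |D v| ≤ ((T / g : ℕ) : ℤ) := by
        push_cast
        rw [Int.le_ediv_iff_mul_le (by exact_mod_cast hg)]
        rw [abs_mul, Nat.abs_cast] at h3
        linarith
      refine ⟨⟨right_ne_zero_of_mul h2, abs_le.1 h4⟩, ?_⟩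
      have : v ≤ N / u := (Nat.le_div_iff_mul_le hu).2 (by rw [mul_comm]; exact h1)
      exact Nat.lt_succ_of_le (Nat.div_le_div_right this)
    · intro v hv v' hv' h
      simp only [Prod.mk.injEq] at h
      obtain ⟨h1, h2⟩ := h
      have hmod : v ≡ v' [MOD M] := by
        have h3 : (A * v : ℕ) ≡ A * v' [MOD M] := by
          rw [Nat.modEq_iff_dvd]
          refine ⟨sg v' - sg v, ?_⟩
          simp only [D] at h1
          push_cast
          linarith
        exact Nat.ModEq.cancel_left_of_coprime (by rwa [Nat.Coprime] at hcop) h3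
      rw [← Nat.div_add_mod v M, ← Nat.div_add_mod v' M, h2, hmod]
  have hcard2 : (((Finset.Icc (-((T / g : ℕ) : ℤ)) ((T / g : ℕ) : ℤ)).erase 0) ×ˢ Finset.range (N / u / M + 1)).card = 2 * (T / g) * (N / u / M + 1) := by
    rw [Finset.card_product, Finset.card_range, Finset.card_erase_of_mem (Finset.mem_Icc.2 ⟨by have := Int.natCast_nonneg (T / g); linarith, Int.natCast_nonneg _⟩), Int.card_Icc]
    congr 1
    have : (0:ℤ) ≤ ((T / g : ℕ) : ℤ) := Int.natCast_nonneg _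
    generalize T / g = w at *
    omega
  rw [hcard2] at hcard
  have h1 : (S.card : ℝ) ≤ 2 * ((T / g : ℕ) : ℝ) * (((N / u / M : ℕ) : ℝ) + 1) := by exact_mod_cast hcard
  have h2 : ((T / g : ℕ) : ℝ) ≤ (T:ℝ) / g := Nat.cast_div_le
  have h3 : ((N / u / M : ℕ) : ℝ) ≤ (N:ℝ) / u / M := Nat.cast_div_le.trans (by gcongr; exact Nat.cast_div_le)
  have hgR : (1:ℝ) ≤ g := by exact_mod_cast hg
  have huR : (0:ℝ) < u := by exact_mod_cast hu
  have hMR : (0:ℝ) < M := by exact_mod_cast hMpos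
  have h4 : (T:ℝ) / g * (N / u / M) ≤ T * (N / (u:ℝ)^2) := by
    have : (u:ℝ) ≤ M * g := by exact_mod_cast huM
    calc (T:ℝ) / g * (N / u / M) = T * (N / (u * (M * g))) := by field_simp
      _ ≤ T * (N / (u * u)) := by gcongr
      _ = _ := by rw [sq]
  have h5 : (T:ℝ) / g ≤ T := div_le_self (by positivity) hgR
  calc (S.card : ℝ) ≤ 2 * ((T / g : ℕ) : ℝ) * (((N / u / M : ℕ) : ℝ) + 1) := h1
    _ ≤ 2 * ((T:ℝ) / g) * ((N:ℝ) / u / M + 1) := by gcongr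
    _ = 2 * ((T:ℝ) / g * (N / u / M)) + 2 * ((T:ℝ) / g) := by ring
    _ ≤ _ := by linarith

lemma sum_inv_sq (Y Z : ℕ) (hY : 0 < Y) : ∑ u ∈ Finset.Ioc Y Z, 1 / (u:ℝ) ^ 2 ≤ 1 / (Y:ℝ) := by
  rcases le_total Y Z with h | h
  · have := sum_Ioc_inv_sq_le_sub (α := ℝ) hY.ne' h
    simp only [one_div]
    have h0 : (0:ℝ) ≤ (Z:ℝ)⁻¹ := by positivity
    linarith
  · rw [Finset.Ioc_eq_empty (by omega)]; simp

lemma count_E1 (a b N T Y Z : ℕ) (ha : 0 < a) (hb : 0 < b) (hY : 0 < Y) (S : Finset ℕ)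
    (hS : ∀ n ∈ S, n ≤ N ∧ (b * sg n : ℤ) - a * n ≠ 0 ∧ |(b * sg n : ℤ) - a * n| ≤ T ∧
      ∃ u v, n = u * v ∧ Nat.Coprime u v ∧ Y < u ∧ u ≤ Z) :
    (S.card : ℝ) ≤ 2 * T * N / Y + 2 * T * Z := by
  classical
  choose! h1 h2 h3 uu vv he hc hl hr using hS
  have hcard : S.card ≤ ∑ u ∈ Finset.Ioc Y Z, (S.filter (fun n => uu n = u)).card :=
    (Finset.card_eq_sum_card_fiberwise (fun n hn => by simpa using ⟨hl n hn, hr n hn⟩)).le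
  have hf : ∀ u ∈ Finset.Ioc Y Z, ((S.filter (fun n => uu n = u)).card : ℝ) ≤ 2 * T * (N / (u:ℝ) ^ 2) + 2 * T := by
    intro u hu
    rw [Finset.mem_Ioc] at hu
    have hi : (S.filter (fun n => uu n = u)).card = ((S.filter (fun n => uu n = u)).image vv).card := by
      rw [Finset.card_image_of_injOn]
      intro n hn n' hn' h
      simp only [Finset.coe_filter, Set.mem_ofPred_eq] at hn hn'
      rw [he n hn.1, he n' hn'.1, hn.2, hn'.2, h]
    rw [hi]
    apply count_u a b u N T ha hb (by omega)
    intro v hv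
    obtain ⟨n, hn, rfl⟩ := Finset.mem_image.1 hv
    obtain ⟨hnS, rfl⟩ := Finset.mem_filter.1 hn
    replace hn := hnS
    have e := he n hn
    have e2 : sg n = sg (uu n) * sg (vv n) := by rw [← sg_mul (hc n hn), ← e]
    have e3 : (b * sg (uu n) * sg (vv n) : ℤ) - a * uu n * vv n = (b * sg n : ℤ) - a * n := by
      have e4 : (n:ℤ) = uu n * vv n := by exact_mod_cast e
      rw [e2]; push_cast; linear_combination (a:ℤ) * e4
    rw [e3, ← e]
    exact ⟨h1 n hn, h2 n hn, h3 n hn⟩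
  calc (S.card : ℝ) ≤ ∑ u ∈ Finset.Ioc Y Z, ((S.filter (fun n => uu n = u)).card : ℝ) := by exact_mod_cast hcard
    _ ≤ ∑ u ∈ Finset.Ioc Y Z, (2 * T * (N / (u:ℝ) ^ 2) + 2 * T) := Finset.sum_le_sum hf
    _ = 2 * T * N * (∑ u ∈ Finset.Ioc Y Z, 1 / (u:ℝ)^2) + 2 * T * ((Z - Y : ℕ) : ℝ) := by
        rw [Finset.sum_add_distrib, Finset.sum_const, Nat.card_Ioc, nsmul_eq_mul, Finset.mul_sum]
        congr 1
        · refine Finset.sum_congr rfl fun u _ => by ring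
        · ring
    _ ≤ 2 * T * N * (1 / Y) + 2 * T * Z := by
        gcongr
        · exact sum_inv_sq Y Z hY
        · omega
    _ = _ := by ring

lemma count_E2 (N D : ℕ) (hD : 0 < D) (S : Finset ℕ) 
    (hS : ∀ n ∈ S, 0 < n ∧ n ≤ N ∧ ∃ d, D < d ∧ d ^ 2 ∣ n) : (S.card : ℝ) ≤ N / D := by
  classical
  choose! h0 h1 dd hd hdv using hS
  have hcard : S.card ≤ ∑ u ∈ Finset.Ioc D N, (S.filter (fun n => dd n = u)).card := by
    refine (Finset.card_eq_sum_card_fiberwise (fun n hn => ?_)).le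
    simp only [Finset.coe_Ioc, Set.mem_Ioc]
    refine ⟨hd n hn, ?_⟩
    have := Nat.le_of_dvd (h0 n hn) (hdv n hn)
    have := h1 n hn
    nlinarith [hd n hn]
  have hf : ∀ u ∈ Finset.Ioc D N, ((S.filter (fun n => dd n = u)).card : ℝ) ≤ N * (1 / (u:ℝ) ^ 2) := by
    intro u hu
    have hu0 : 0 < u := by rw [Finset.mem_Ioc] at hu; omega
    have : (S.filter (fun n => dd n = u)).card ≤ N / u ^ 2 := by
      rw [← Nat.Ioc_filter_dvd_card_eq_div]
      refine Finset.card_le_card fun n hn => ?_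
      obtain ⟨hnS, rfl⟩ := Finset.mem_filter.1 hn
      replace hn := hnS
      simp only [Finset.mem_filter, Finset.mem_Ioc]
      exact ⟨⟨h0 n hn, h1 n hn⟩, hdv n hn⟩
    calc _ ≤ ((N / u ^ 2 : ℕ) : ℝ) := by exact_mod_cast this
      _ ≤ (N:ℝ) / (u ^ 2 : ℕ) := Nat.cast_div_le
      _ = _ := by push_cast; ring
  calc (S.card : ℝ) ≤ ∑ u ∈ Finset.Ioc D N, ((S.filter (fun n => dd n = u)).card : ℝ) := by exact_mod_cast hcard
    _ ≤ ∑ u ∈ Finset.Ioc D N, N * (1 / (u:ℝ) ^ 2) := Finset.sum_le_sum hf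
    _ = N * ∑ u ∈ Finset.Ioc D N, (1 / (u:ℝ) ^ 2) := by rw [Finset.mul_sum]
    _ ≤ N * (1 / D) := by gcongr; exact sum_inv_sq D N hD
    _ = _ := by ring

/-- a number with no unitary divisor in `(Y, Y^2]` has a large component -/
lemma big_component (n Y : ℕ) (hY : 0 < Y) (hn : Y ^ 2 < n)
    (hno : ∀ u v, n = u * v → Nat.Coprime u v → Y < u → Y ^ 2 < u) :
    ∃ p, p.Prime ∧ Y ^ 2 < cmp n p := by
  classical
  by_contra hcon
  push Not at hcon
  have hn0 : n ≠ 0 := by omega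
  have hcmp : ∀ p, p.Prime → cmp n p ≤ Y := by
    intro p hp
    by_contra h
    push Not at h
    have := hno (cmp n p) (n / cmp n p) (Nat.ordProj_mul_ordCompl_eq_self n p).symm
      ((Nat.coprime_ordCompl hp hn0).pow_left _) h
    exact absurd (hcon p hp) (by omega)
  -- partial products over sets of primes
  have key : ∀ s : Finset ℕ, s ⊆ n.primeFactors → ∏ p ∈ s, cmp n p ≤ Y := by
    intro s
    induction s using Finset.induction_on with
    | empty => intro _; simp; omega
    | insert p s hps ih =>
      intro hs
      have hp := Nat.mem_primeFactors.1 (hs (Finset.mem_insert_self p s))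
      have ih' := ih ((Finset.subset_insert p s).trans hs)
      rw [Finset.prod_insert hps]
      by_contra h
      push Not at h
      have hsplit : n = (∏ q ∈ insert p s, cmp n q) * ∏ q ∈ n.primeFactors \ insert p s, cmp n q := by
        rw [mul_comm, Finset.prod_sdiff hs]
        exact (Nat.prod_factorization_pow_eq_self hn0).symm
      have hco : Nat.Coprime (∏ q ∈ insert p s, cmp n q) (∏ q ∈ n.primeFactors \ insert p s, cmp n q) := by
        refine Nat.Coprime.prod_left fun q hq => Nat.Coprime.prod_right fun r hr => ?_
        have hq' := Nat.mem_primeFactors.1 (hs hq)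
        have hr' := Finset.mem_sdiff.1 hr
        have hr'' := Nat.mem_primeFactors.1 hr'.1
        refine Nat.Coprime.pow _ _ ((Nat.coprime_primes hq'.1 hr''.1).2 ?_)
        rintro rfl
        exact hr'.2 hq
      have h2 := hno _ _ hsplit hco (by rw [Finset.prod_insert hps]; exact h)
      rw [Finset.prod_insert hps] at h2
      have h3 := Nat.mul_le_mul (hcmp p hp.1) ih'
      nlinarith
  have := key n.primeFactors subset_rfl
  have e : ∏ p ∈ n.primeFactors, cmp n p = n := Nat.prod_factorization_pow_eq_self hn0
  rw [e] at this
  nlinarith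

lemma decomp (a b N T Y D n : ℕ) (hb : 0 < b) (hY : 64 ≤ Y) (hN : N ≤ 8 * Y ^ 3) (hN' : Y ^ 3 ≤ N)
    (hT : T + 8 * a * Y ≤ Y ^ 2) (hD : D ^ 2 ≤ Y)
    (hn1 : 1 ≤ n) (hnN : n ≤ N) (hΔ : |(b * sg n : ℤ) - a * n| ≤ T) :
    n ≤ Y ^ 2 ∨ n ∈ perfSet a b N ∨ 
    ((b * sg n : ℤ) - a * n ≠ 0 ∧ ∃ u v, n = u * v ∧ Nat.Coprime u v ∧ Y < u ∧ u ≤ Y ^ 2) ∨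
    (∃ d, D < d ∧ d ^ 2 ∣ n) ∨
    (∃ m p, n = p * m ∧ p.Prime ∧ 0 < m ∧ b * sg m = a * m ∧ m * m ≤ N) := by
  by_cases c1 : n ≤ Y ^ 2
  · exact Or.inl c1
  right
  by_cases c2 : (b * sg n : ℤ) - a * n = 0
  · left
    exact mem_perfSet.2 ⟨⟨hn1, hnN⟩, by have := sub_eq_zero.1 c2; exact_mod_cast this⟩
  right
  by_cases c3 : ∃ u v, n = u * v ∧ Nat.Coprime u v ∧ Y < u ∧ u ≤ Y ^ 2
  · exact Or.inl ⟨c2, c3⟩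
  right
  obtain ⟨p, hp, hpY⟩ := big_component n Y (by omega) (by omega) (by
    intro u v h1 h2 h3
    by_contra h
    exact c3 ⟨u, v, h1, h2, h3, by omega⟩)
  set e := n.factorization p with he
  have hdvd : p ^ e ∣ n := Nat.ordProj_dvd n p
  rcases Nat.lt_or_ge e 2 with h2 | h2
  · right
    have he1 : e = 1 := by
      have : e ≠ 0 := by
        intro h0
        simp only [cmp, ← he, h0, pow_zero] at hpY
        nlinarith
      omega
    have hsplit : p * (n / p) = n := by
      have := Nat.ordProj_mul_ordCompl_eq_self n p
      rw [← he, he1, pow_one] at this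
      exact this
    have hco : Nat.Coprime p (n / p) := by
      have := Nat.coprime_ordCompl hp (show n ≠ 0 by omega)
      rw [← he, he1, pow_one] at this
      exact this
    simp only [cmp, ← he, he1, pow_one] at hpY
    set m := n / p with hm
    have hm0 : 0 < m := Nat.pos_of_ne_zero (by rintro h; rw [h] at hsplit; omega)
    have hmY : m < 8 * Y := by
      by_contra h
      push Not at h
      have : (Y ^ 2 + 1) * (8 * Y) ≤ p * m := Nat.mul_le_mul hpY h
      nlinarith
    refine ⟨m, p, hsplit.symm, hp, hm0, ?_, ?_⟩
    · have hs : sg n = (p + 1) * sg m := by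
        rw [← hsplit, sg_mul hco]
        congr 1
        have := ArithmeticFunction.sigma_one_apply_prime_pow (i := 1) hp
        rw [pow_one] at this
        unfold sg; rw [this]; simp [Finset.sum_range_succ, add_comm]
      have hnZ : (n:ℤ) = p * m := by exact_mod_cast hsplit.symm
      have hsZ : (sg n : ℤ) = (p + 1) * sg m := by exact_mod_cast hs
      rw [hnZ, hsZ] at hΔ
      obtain ⟨l1, l2⟩ := abs_le.1 hΔ
      have hTZ : (T:ℤ) + 8 * a * Y ≤ Y ^ 2 := by exact_mod_cast hT
      have hpZ : (Y:ℤ)^2 < p := by exact_mod_cast hpY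
      have hmZ : (m:ℤ) < 8 * Y := by exact_mod_cast hmY
      have hmZ0 : (0:ℤ) < m := by exact_mod_cast hm0
      have hp0 : (0:ℤ) < p := by exact_mod_cast hp.pos
      have ha0 : (0:ℤ) ≤ a := by positivity
      have haY : (0:ℤ) ≤ a * Y := by positivity
      have hbs : (0:ℤ) ≤ b * sg m := by positivity
      have ham : (a:ℤ) * m ≤ a * (8 * Y) := by gcongr
      have hid : (b:ℤ) * ((p+1) * sg m) - a * (p * m) = p * (b * sg m - a * m) + b * sg m := by ring
      rw [hid] at l1 l2
      rcases lt_trichotomy ((b:ℤ) * sg m) (a * m) with h | h | h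
      · exfalso
        have : (p:ℤ) * (b * sg m - a * m) ≤ p * (-1) := by
          apply mul_le_mul_of_nonneg_left _ hp0.le; omega
        linarith
      · exact_mod_cast h
      · exfalso
        have : (p:ℤ) * 1 ≤ p * (b * sg m - a * m) := by
          apply mul_le_mul_of_nonneg_left _ hp0.le; omega
        linarith
    · nlinarith
  · left
    refine ⟨p ^ (e / 2), ?_, ?_⟩
    · by_contra h
      push Not at h
      have h3 : p ^ e ≤ (p ^ (e / 2)) ^ 3 := by
        rw [← pow_mul]; exact Nat.pow_le_pow_right hp.pos (by omega)
      have h5 : p ^ (e/2) ≥ 2 := (hp.two_le).trans (Nat.le_self_pow (by omega) p)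
      set d := p ^ (e / 2)
      have h4 : d ^ 2 ≤ Y := (Nat.pow_le_pow_left h 2).trans hD
      have h6 : d ^ 3 ≤ (d ^ 2) ^ 2 := by
        rw [← pow_mul d 2 2]
        exact Nat.pow_le_pow_right (by omega : 0 < d) (by norm_num : 3 ≤ 2 * 2)
      have h7 : (d ^ 2) ^ 2 ≤ Y ^ 2 := Nat.pow_le_pow_left h4 2
      have : Y ^ 2 < p ^ e := hpY
      omega
    · rw [← pow_mul]
      exact (pow_dvd_pow p (by omega)).trans hdvd

lemma count_pm (a b N : ℕ) (S : Finset ℕ) (hS : ∀ n ∈ S, n ≤ N ∧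
      ∃ m p, n = p * m ∧ p.Prime ∧ 0 < m ∧ b * sg m = a * m ∧ m * m ≤ N) :
    S.card ≤ ∑ m ∈ (perfSet a b N).filter (fun m => m * m ≤ N), Nat.primeCounting (N / m) := by
  classical
  choose! h1 mm pp he hp hm hperf hmm using hS
  rw [Finset.card_eq_sum_card_fiberwise (f := mm) (t := (perfSet a b N).filter (fun m => m * m ≤ N))]
  · refine Finset.sum_le_sum fun m hm' => ?_
    rw [← Nat.primesLE_card_eq_primeCounting]
    refine Finset.card_le_card_of_injOn pp ?_ ?_
    · intro n hn
      obtain ⟨hnS, rfl⟩ := Finset.mem_filter.1 (Finset.mem_coe.1 hn)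
      replace hn := hnS
      refine Finset.mem_coe.2 (Nat.mem_primesLE.2 ⟨?_, hp n hn⟩)
      rw [Nat.le_div_iff_mul_le (hm n hn), ← he n hn]
      exact h1 n hn
    · intro n hn n' hn' h
      have q1 := Finset.mem_filter.1 (Finset.mem_coe.1 hn)
      have q2 := Finset.mem_filter.1 (Finset.mem_coe.1 hn')
      rw [he n q1.1, he n' q2.1, h, q1.2, q2.2]
  · intro n hn
    simp only [Finset.coe_filter, Set.mem_ofPred_eq]
    refine ⟨mem_perfSet.2 ⟨⟨hm n hn, ?_⟩, hperf n hn⟩, hmm n hn⟩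
    nlinarith [hmm n hn, hm n hn]

end WP
end Part6

section Part7
open Filter Topology
namespace WP

lemma upper_finite (a b N T Y D : ℕ) (ha : 0 < a) (hb : 0 < b) (hY : 64 ≤ Y) (hN : N ≤ 8 * Y ^ 3) (hN' : Y ^ 3 ≤ N)
    (hT : T + 8 * a * Y ≤ Y ^ 2) (hD : D ^ 2 ≤ Y) (hD0 : 0 < D) (S : Finset ℕ)
    (hS : ∀ n ∈ S, 1 ≤ n ∧ n ≤ N ∧ |(b * sg n : ℤ) - a * n| ≤ T) :
    (S.card : ℝ) ≤ Y ^ 2 + (perfSet a b N).card + (2 * T * N / Y + 2 * T * (Y ^ 2 : ℕ)) + N / D + 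
      ∑ m ∈ (perfSet a b N).filter (fun m => m * m ≤ N), (Nat.primeCounting (N / m) : ℝ) := by
  classical
  set P1 : ℕ → Prop := fun n => ((b * sg n : ℤ) - a * n ≠ 0 ∧ ∃ u v, n = u * v ∧ Nat.Coprime u v ∧ Y < u ∧ u ≤ Y ^ 2)
  set P2 : ℕ → Prop := fun n => (∃ d, D < d ∧ d ^ 2 ∣ n)
  set P3 : ℕ → Prop := fun n => (∃ m p, n = p * m ∧ p.Prime ∧ 0 < m ∧ b * sg m = a * m ∧ m * m ≤ N)
  have hsub : S ⊆ Finset.Icc 1 (Y ^ 2) ∪ perfSet a b N ∪ S.filter P1 ∪ S.filter P2 ∪ S.filter P3 := by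
    intro n hn
    obtain ⟨h1, h2, h3⟩ := hS n hn
    simp only [Finset.mem_union, Finset.mem_filter, Finset.mem_Icc]
    rcases decomp a b N T Y D n hb hY hN hN' hT hD h1 h2 h3 with h | h | h | h | h
    · exact Or.inl (Or.inl (Or.inl (Or.inl ⟨h1, h⟩)))
    · exact Or.inl (Or.inl (Or.inl (Or.inr h)))
    · exact Or.inl (Or.inl (Or.inr ⟨hn, h⟩))
    · exact Or.inl (Or.inr ⟨hn, h⟩)
    · exact Or.inr ⟨hn, h⟩
  have hc : S.card ≤ Y ^ 2 + (perfSet a b N).card + (S.filter P1).card + (S.filter P2).card + (S.filter P3).card := by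
    refine (Finset.card_le_card hsub).trans ?_
    refine (Finset.card_union_le _ _).trans (Nat.add_le_add_right ?_ _)
    refine (Finset.card_union_le _ _).trans (Nat.add_le_add_right ?_ _)
    refine (Finset.card_union_le _ _).trans (Nat.add_le_add_right ?_ _)
    refine (Finset.card_union_le _ _).trans (Nat.add_le_add_right ?_ _)
    simp
  have e1 := count_E1 a b N T Y (Y ^ 2) ha hb (by omega) (S.filter P1) (by
    intro n hn
    obtain ⟨hn, h⟩ := Finset.mem_filter.1 hn
    exact ⟨(hS n hn).2.1, h.1, (hS n hn).2.2, h.2⟩)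
  have e2 := count_E2 N D hD0 (S.filter P2) (by
    intro n hn
    obtain ⟨hn, h⟩ := Finset.mem_filter.1 hn
    exact ⟨(hS n hn).1, (hS n hn).2.1, h⟩)
  have e3 := count_pm a b N (S.filter P3) (by
    intro n hn
    obtain ⟨hn, h⟩ := Finset.mem_filter.1 hn
    exact ⟨(hS n hn).2.1, h⟩)
  have e3' : ((S.filter P3).card : ℝ) ≤ ∑ m ∈ (perfSet a b N).filter (fun m => m * m ≤ N), (Nat.primeCounting (N / m) : ℝ) := by
    exact_mod_cast e3
  have hc' : (S.card : ℝ) ≤ Y ^ 2 + (perfSet a b N).card + (S.filter P1).card + (S.filter P2).card + (S.filter P3).card := by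
    exact_mod_cast hc
  linarith

/-- the main term -/
noncomputable def hx (a b : ℕ) (x : ℝ) (m : ℕ) : ℝ := by
  classical exact if m ∈ (perfSet a b ⌊x⌋₊).filter (fun m => m * m ≤ ⌊x⌋₊) then
    (Nat.primeCounting (⌊x⌋₊ / m) : ℝ) * Real.log x / x else 0

lemma pi_div (m : ℕ) (hm : 0 < m) :
    Tendsto (fun x : ℝ => (Nat.primeCounting (⌊x⌋₊ / m) : ℝ) * Real.log x / x) atTop (𝓝 (1 / (m:ℝ))) := by
  have hm' : (0:ℝ) < m := by exact_mod_cast hm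
  have h1 : Tendsto (fun x : ℝ => x / m) atTop atTop := tendsto_id.atTop_div_const hm'
  have h2 := pnt.comp h1
  have h3 : Tendsto (fun x : ℝ => 1 - Real.log m / Real.log x) atTop (𝓝 (1 - 0)) :=
    tendsto_const_nhds.sub (tendsto_const_nhds.div_atTop Real.tendsto_log_atTop)
  rw [sub_zero] at h3
  have h4 := (h2.div h3 one_ne_zero).mul_const (1 / (m:ℝ))
  rw [div_one, one_mul] at h4
  refine h4.congr' ?_
  filter_upwards [eventually_gt_atTop (max 1 (m:ℝ))] with x hx
  have hx1 : 1 < x := (le_max_left _ _).trans_lt hx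
  have hxm : (m:ℝ) < x := (le_max_right _ _).trans_lt hx
  have hl : 0 < Real.log x := Real.log_pos hx1
  have hl2 : 0 < Real.log x - Real.log m := sub_pos.2 (Real.log_lt_log hm' hxm)
  simp only [Function.comp, Pi.div_apply]
  rw [Nat.floor_div_natCast, Real.log_div (by positivity) hm'.ne']
  have : 1 - Real.log m / Real.log x = (Real.log x - Real.log m) / Real.log x := by field_simp
  rw [this]
  field_simp

lemma hx_dom (a b : ℕ) : ∀ᶠ x : ℝ in atTop, ∀ m, ‖hx a b x m‖ ≤ 4 * fw a b m := by
  have h := (pnt.eventually (gt_mem_nhds (show (1:ℝ) < 2 by norm_num)))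
  obtain ⟨t0, ht0⟩ := eventually_atTop.1 h
  filter_upwards [eventually_gt_atTop (1:ℝ), eventually_ge_atTop ((max t0 1)^2)] with x hx1 hx2 m
  have hl : 0 < Real.log x := Real.log_pos hx1
  have hfl : (⌊x⌋₊ : ℝ) ≤ x := Nat.floor_le (by linarith)
  unfold hx fw
  by_cases hm : m ∈ (perfSet a b ⌊x⌋₊).filter (fun m => m * m ≤ ⌊x⌋₊)
  · obtain ⟨hp, hmm⟩ := Finset.mem_filter.1 hm
    obtain ⟨⟨hm1, hm2⟩, hm3⟩ := mem_perfSet.1 hp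
    rw [if_pos hm, if_pos ⟨hm1, hm3⟩, Real.norm_of_nonneg (by positivity)]
    have hm' : (1:ℝ) ≤ m := by exact_mod_cast hm1
    have hmm' : (m:ℝ) * m ≤ x := le_trans (by exact_mod_cast hmm) hfl
    have ht2 : x ≤ (x / m) ^ 2 := by
      rw [div_pow, le_div_iff₀ (by positivity)]; nlinarith
    have htp : 0 < x / m := by positivity
    have ht : max t0 1 ≤ x / m := by
      refine le_of_sq_le_sq ?_ htp.le
      exact hx2.trans ht2
    have hk := ht0 (x / m) ((le_max_left _ _).trans ht)
    rw [Nat.floor_div_natCast] at hk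
    have hlt : Real.log x ≤ 2 * Real.log (x / m) := by
      have := Real.log_le_log (by linarith) ht2
      rwa [Real.log_pow] at this
    have hk2 := (div_lt_iff₀ htp).1 hk
    rw [div_le_iff₀ (by linarith)]
    have hpi : (0:ℝ) ≤ (Nat.primeCounting (⌊x⌋₊ / m) : ℝ) := by positivity
    calc _ ≤ (Nat.primeCounting (⌊x⌋₊ / m) : ℝ) * (2 * Real.log (x / m)) := by gcongr
      _ ≤ 2 * (2 * (x / m)) := by linarith
      _ = _ := by ring
  · rw [if_neg hm]
    simp only [norm_zero]
    split_ifs <;> positivity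

lemma hx_tendsto (a b : ℕ) (ha : 0 < a) (hb : 0 < b) :
    Tendsto (fun x : ℝ => ∑' m, hx a b x m) atTop (𝓝 (∑' m, fw a b m)) := by
  refine tendsto_tsum_of_dominated_convergence (bound := fun m => 4 * fw a b m) ((fw_summable a b ha hb).mul_left 4) ?_ (hx_dom a b)
  intro m
  by_cases h : 0 < m ∧ b * sg m = a * m
  · have : fw a b m = 1 / (m:ℝ) := by unfold fw; rw [if_pos h]
    rw [this]
    refine (pi_div m h.1).congr' ?_
    filter_upwards [eventually_ge_atTop ((m * m : ℕ) : ℝ)] with x hx'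
    have h2 : m * m ≤ ⌊x⌋₊ := Nat.le_floor hx'
    unfold hx
    rw [if_pos]
    refine Finset.mem_filter.2 ⟨mem_perfSet.2 ⟨⟨h.1, ?_⟩, h.2⟩, h2⟩
    nlinarith [h.1]
  · have : fw a b m = 0 := by unfold fw; rw [if_neg h]
    rw [this]
    refine tendsto_const_nhds.congr fun x => ?_
    unfold hx
    rw [if_neg]
    intro hm
    have := mem_perfSet.1 (Finset.mem_filter.1 hm).1
    exact h ⟨this.1.1, this.2⟩

lemma hx_sum (a b : ℕ) (x : ℝ) : ∑' m, hx a b x m = 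
    (∑ m ∈ (perfSet a b ⌊x⌋₊).filter (fun m => m * m ≤ ⌊x⌋₊), (Nat.primeCounting (⌊x⌋₊ / m) : ℝ)) / (x / Real.log x) := by
  rw [tsum_eq_sum (s := (perfSet a b ⌊x⌋₊).filter (fun m => m * m ≤ ⌊x⌋₊)), Finset.sum_div]
  · refine Finset.sum_congr rfl fun m hm => ?_
    unfold hx
    rw [if_pos hm, div_div_eq_mul_div]
  · intro m hm
    unfold hx
    rw [if_neg hm]

lemma rpow_small (s : ℝ) (hs : s < 1) : Tendsto (fun x : ℝ => x ^ s / (x / Real.log x)) atTop (𝓝 0) := by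
  have := (isLittleO_log_rpow_atTop (show 0 < 1 - s by linarith)).tendsto_div_nhds_zero
  refine this.congr' ?_
  filter_upwards [eventually_gt_atTop (1:ℝ)] with x hx
  have hl : 0 < Real.log x := Real.log_pos hx
  rw [Real.rpow_sub (by linarith), Real.rpow_one]
  have : 0 < x ^ s := Real.rpow_pos_of_pos (by linarith) _
  field_simp

lemma upper_x (a b : ℕ) (ha : 0 < a) (hb : 0 < b) (c : ℝ) (hc0 : 0 < c) (hc : c < 1/3) :
    ∀ᶠ x : ℝ in atTop, ∀ S : Finset ℕ, 
      (∀ n ∈ S, 1 ≤ n ∧ (n:ℝ) ≤ x ∧ |(b * sg n : ℝ) - a * n| ≤ b * x ^ c) →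
      (S.card : ℝ) / (x / Real.log x) ≤ x ^ (2/3 : ℝ) / (x / Real.log x) + ((perfSet a b ⌊x⌋₊).card : ℝ) / (x / Real.log x)
        + 18 * b * (x ^ (c + 2/3) / (x / Real.log x)) + 2 * (x ^ (5/6 : ℝ) / (x / Real.log x)) + ∑' m, hx a b x m := by
  have hy : Tendsto (fun x : ℝ => ⌊x ^ (1/3 : ℝ)⌋₊) atTop atTop := tendsto_nat_floor_atTop.comp (tendsto_rpow_atTop (by norm_num))
  filter_upwards [hy.eventually_ge_atTop (64 + 16 * a + 4 * b), eventually_gt_atTop (1:ℝ)] with x hY hx1 S hS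
  have hx0 : 0 < x := by linarith
  have hl : 0 < Real.log x := Real.log_pos hx1
  set Y := ⌊x ^ (1/3 : ℝ)⌋₊ with hYd
  set N := ⌊x⌋₊ with hNd
  set T := ⌊b * x ^ c⌋₊ with hTd
  set D := ⌊x ^ (1/6 : ℝ)⌋₊ with hDd
  set y := x ^ (1/3 : ℝ) with hyd
  set w := x ^ (1/6 : ℝ) with hwd
  have hy0 : 0 < y := Real.rpow_pos_of_pos hx0 _
  have hw1 : 1 ≤ w := Real.one_le_rpow hx1.le (by norm_num)
  have hy3 : y ^ 3 = x := by rw [hyd, ← Real.rpow_natCast, ← Real.rpow_mul hx0.le]; norm_num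
  have hw2 : w ^ 2 = y := by rw [hyd, hwd, ← Real.rpow_natCast, ← Real.rpow_mul hx0.le]; norm_num
  have hYy : (Y:ℝ) ≤ y := Nat.floor_le hy0.le
  have hYy' : y < Y + 1 := Nat.lt_floor_add_one _
  have hNx : (N:ℝ) ≤ x := Nat.floor_le hx0.le
  have hDw : (D:ℝ) ≤ w := Nat.floor_le (by linarith)
  have hDw' : w < D + 1 := Nat.lt_floor_add_one _
  have hD1 : 1 ≤ D := Nat.le_floor (by rw [Nat.cast_one]; exact hw1)
  have hD1' : (1:ℝ) ≤ D := by exact_mod_cast hD1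
  have hY1' : (64:ℝ) + 16 * a + 4 * b ≤ Y := by exact_mod_cast hY
  have haR : (1:ℝ) ≤ a := by exact_mod_cast ha
  have hbR : (1:ℝ) ≤ b := by exact_mod_cast hb
  have hTx : (T:ℝ) ≤ b * x ^ c := Nat.floor_le (by positivity)
  have hxc : x ^ c ≤ y := Real.rpow_le_rpow_of_exponent_le hx1.le hc.le
  have hN8 : N ≤ 8 * Y ^ 3 := by
    have : (N:ℝ) ≤ 8 * (Y:ℝ) ^ 3 := by
      calc (N:ℝ) ≤ y ^ 3 := by rw [hy3]; exact hNx
        _ ≤ (2 * Y) ^ 3 := by gcongr; linarith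
        _ = _ := by ring
    exact_mod_cast this
  have hYN : Y ^ 3 ≤ N := by
    apply Nat.le_floor
    push_cast
    calc (Y:ℝ) ^ 3 ≤ y ^ 3 := by gcongr
      _ = x := hy3
  have hTY : T + 8 * a * Y ≤ Y ^ 2 := by
    have h1 : (T:ℝ) ≤ b * (2 * Y) := hTx.trans (by gcongr; linarith)
    have : (T:ℝ) + 8 * a * Y ≤ Y ^ 2 := by nlinarith
    exact_mod_cast this
  have hDY : D ^ 2 ≤ Y := by
    apply Nat.le_floor
    push_cast
    calc (D:ℝ) ^ 2 ≤ w ^ 2 := by gcongr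
      _ = y := hw2
  have hmain := upper_finite a b N T Y D ha hb (by omega) hN8 hYN hTY hDY (by omega) S (by
    intro n hn
    obtain ⟨h1, h2, h3⟩ := hS n hn
    refine ⟨h1, Nat.le_floor h2, ?_⟩
    have h4 : (((|(b * sg n : ℤ) - a * n|).toNat : ℕ) : ℝ) = |(b * sg n : ℝ) - a * n| := by
      have : (((|(b * sg n : ℤ) - a * n|).toNat : ℤ)) = |(b * sg n : ℤ) - a * n| := Int.toNat_of_nonneg (abs_nonneg _)
      exact_mod_cast congrArg (fun z : ℤ => (z:ℝ)) this
    have h5 : (|(b * sg n : ℤ) - a * n|).toNat ≤ T := Nat.le_floor (by rw [h4]; exact h3)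
    omega)
  have hx23 : y ^ 2 = x ^ (2/3 : ℝ) := by rw [hyd, ← Real.rpow_natCast, ← Real.rpow_mul hx0.le]; norm_num
  have t1 : (Y:ℝ) ^ 2 ≤ x ^ (2/3 : ℝ) := by rw [← hx23]; gcongr
  have hYp : (0:ℝ) < Y := by linarith
  have t2 : 2 * T * N / Y + 2 * T * ((Y ^ 2 : ℕ) : ℝ) ≤ 18 * b * x ^ (c + 2/3) := by
    have h8 : (N:ℝ) ≤ 8 * (Y:ℝ) ^ 3 := by exact_mod_cast hN8
    have : 2 * (T:ℝ) * N / Y ≤ 16 * T * Y ^ 2 := by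
      rw [div_le_iff₀ hYp]
      calc 2 * (T:ℝ) * N ≤ 2 * T * (8 * (Y:ℝ) ^ 3) := by gcongr
        _ = _ := by ring
    push_cast
    calc _ ≤ 18 * (T:ℝ) * Y ^ 2 := by linarith
      _ ≤ 18 * (b * x ^ c) * x ^ (2/3 : ℝ) := by gcongr
      _ = _ := by rw [Real.rpow_add hx0]; ring
  have t3 : (N:ℝ) / D ≤ 2 * x ^ (5/6 : ℝ) := by
    rw [div_le_iff₀ (by linarith)]
    have e : x = x ^ (5/6 : ℝ) * w := by rw [hwd, ← Real.rpow_add hx0]; norm_num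
    calc (N:ℝ) ≤ x := hNx
      _ = x ^ (5/6 : ℝ) * w := e
      _ ≤ x ^ (5/6 : ℝ) * (2 * D) := by gcongr; linarith
      _ = _ := by ring
  rw [hx_sum]
  have hq : 0 < x / Real.log x := by positivity
  rw [← mul_div_assoc, ← mul_div_assoc, ← add_div, ← add_div, ← add_div, ← add_div]
  gcongr
  linarith

lemma lower_x (a b : ℕ) (hb : 0 < b) (k : ℝ → ℝ) 
    (hkmono : MonotoneOn k (Set.Ici 1))
    (hkunb : ∀ M : ℝ, ∃ y : ℝ, 1 ≤ y ∧ M < k y) (F : Finset ℕ)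
    (hF : ∀ m ∈ F, 0 < m ∧ b * sg m = a * m) :
    ∃ P0 : ℕ, ∀ x : ℝ, ∀ S : Finset ℕ,
      (∀ n : ℕ, 1 ≤ n → (n:ℝ) ≤ x → |(sg n : ℝ) - (a / b : ℝ) * n| < k n → n ∈ S) →
      ∑ m ∈ F, ((Nat.primeCounting (⌊x⌋₊ / m) : ℝ) - P0) ≤ S.card := by
  classical
  obtain ⟨y1, hy1, hky⟩ := hkunb ((a / b : ℝ) * (F.sup id : ℕ))
  refine ⟨F.sup id + ⌈y1⌉₊, fun x S hS => ?_⟩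
  set P0 := F.sup id + ⌈y1⌉₊ with hP0
  set N := ⌊x⌋₊ with hN
  have hFle : ∀ m ∈ F, m ≤ F.sup id := fun m hm => Finset.le_sup (f := id) hm
  let I := F.sigma (fun m => (Nat.primesLE (N / m)).filter (fun p => P0 < p))
  have hI : I.card ≤ S.card := by
    refine Finset.card_le_card_of_injOn (fun i => i.2 * i.1) ?_ ?_
    · rintro ⟨m, p⟩ hi
      simp only [I, Finset.coe_sigma, Set.mem_sigma_iff, Finset.mem_coe, Finset.mem_filter, Nat.mem_primesLE] at hi
      obtain ⟨hm, ⟨hpN, hp⟩, hpP⟩ := hi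
      obtain ⟨hm0, hmp⟩ := hF m hm
      have hmP := hFle m hm
      have hco : Nat.Coprime p m := (hp.coprime_iff_not_dvd).2 (fun h => by
        have := Nat.le_of_dvd hm0 h; omega)
      have hs : sg (p * m) = (p + 1) * sg m := by
        rw [sg_mul hco]
        congr 1
        have := ArithmeticFunction.sigma_one_apply_prime_pow (i := 1) hp
        rw [pow_one] at this
        unfold sg; rw [this]; simp [Finset.sum_range_succ, add_comm]
      have hle : p * m ≤ N := (Nat.le_div_iff_mul_le hm0).1 hpN
      have hpm1 : 1 ≤ p * m := Nat.mul_pos hp.pos hm0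
      have hN0 : 0 < N := by omega
      have hx1 : 1 ≤ x := Nat.floor_pos.1 hN0
      apply hS (p * m) hpm1
      · exact le_trans (by exact_mod_cast hle) (Nat.floor_le (by linarith))
      · have hbR : (0:ℝ) < b := by exact_mod_cast hb
        have hsm : (sg m : ℝ) = a / b * m := by
          have : (b:ℝ) * sg m = a * m := by exact_mod_cast hmp
          field_simp; linarith
        have hsR : (sg (p * m) : ℝ) = (p + 1) * sg m := by exact_mod_cast hs
        rw [hsR, hsm]
        have : ((p:ℝ) + 1) * (a / b * m) - a / b * ((p * m : ℕ) : ℝ) = a / b * m := by push_cast; ring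
        rw [this, abs_of_nonneg (by positivity)]
        have hy1p : y1 ≤ ((p * m : ℕ) : ℝ) := by
          refine (Nat.le_ceil y1).trans ?_
          have : ⌈y1⌉₊ ≤ p * m := by nlinarith
          exact_mod_cast this
        calc (a:ℝ) / b * m ≤ a / b * (F.sup id : ℕ) := by gcongr
          _ < k y1 := hky
          _ ≤ k ((p * m : ℕ) : ℝ) := hkmono (Set.mem_Ici.2 hy1) (Set.mem_Ici.2 (hy1.trans hy1p)) hy1p
    · rintro ⟨m, p⟩ hi ⟨m', p'⟩ hi' h
      simp only [I, Finset.coe_sigma, Set.mem_sigma_iff, Finset.mem_coe, Finset.mem_filter, Nat.mem_primesLE] at hi hi' h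
      obtain ⟨hm, ⟨hpN, hp⟩, hpP⟩ := hi
      obtain ⟨hm', ⟨hpN', hp'⟩, hpP'⟩ := hi'
      have q1 := hFle m' hm'
      have hd : p ∣ p' * m' := ⟨m, h.symm⟩
      have hpp : p = p' := by
        rcases (hp.dvd_mul).1 hd with h1 | h1
        · exact (Nat.prime_dvd_prime_iff_eq hp hp').1 h1
        · have := Nat.le_of_dvd (hF m' hm').1 h1; omega
      subst hpp
      have := Nat.eq_of_mul_eq_mul_left hp.pos h
      subst this
      rfl
  have hcard : I.card = ∑ m ∈ F, ((Nat.primesLE (N / m)).filter (fun p => P0 < p)).card := Finset.card_sigma _ _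
  have hterm : ∀ m ∈ F, (Nat.primeCounting (N / m) : ℝ) - P0 ≤ (((Nat.primesLE (N / m)).filter (fun p => P0 < p)).card : ℝ) := by
    intro m _
    rw [← Nat.primesLE_card_eq_primeCounting, ← Finset.card_filter_add_card_filter_not (s := Nat.primesLE (N / m)) (fun p => P0 < p)]
    have : ((Nat.primesLE (N / m)).filter (fun p => ¬ P0 < p)).card ≤ P0 := by
      calc _ ≤ (Finset.Icc 1 P0).card := by
            refine Finset.card_le_card fun p hp => ?_
            simp only [Finset.mem_filter, Nat.mem_primesLE] at hp
            exact Finset.mem_Icc.2 ⟨hp.1.2.pos, by omega⟩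
        _ = P0 := by simp
    have : (((Nat.primesLE (N / m)).filter (fun p => ¬ P0 < p)).card : ℝ) ≤ P0 := by exact_mod_cast this
    push_cast
    linarith
  calc _ ≤ ∑ m ∈ F, (((Nat.primesLE (N / m)).filter (fun p => P0 < p)).card : ℝ) := Finset.sum_le_sum hterm
    _ = I.card := by rw [hcard]; push_cast; rfl
    _ ≤ S.card := by exact_mod_cast hI

lemma main_limit (a b : ℕ) (ha : 0 < a) (hb : 0 < b) (c : ℝ) (hc0 : 0 < c) (hc : c < 1/3) (k : ℝ → ℝ) 
    (hkmono : MonotoneOn k (Set.Ici 1))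
    (hkunb : ∀ M : ℝ, ∃ y : ℝ, 1 ≤ y ∧ M < k y)
    (hkub : ∀ y : ℝ, 1 ≤ y → k y ≤ y ^ c) (S : ℝ → Finset ℕ)
    (hS : ∀ x n, n ∈ S x ↔ 1 ≤ n ∧ (n:ℝ) ≤ x ∧ |(sg n : ℝ) - (a / b : ℝ) * n| < k n) :
    Tendsto (fun x => ((S x).card : ℝ) / (x / Real.log x)) atTop (𝓝 (∑' m, fw a b m)) := by
  have hbR : (0:ℝ) < b := by exact_mod_cast hb
  refine tendsto_order.2 ⟨fun v hv => ?_, fun v hv => ?_⟩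
  · -- lower bound
    obtain ⟨F0, hF0⟩ := ((fw_summable a b ha hb).hasSum.eventually (lt_mem_nhds hv)).exists
    classical
    let F := F0.filter (fun m => 0 < m ∧ b * sg m = a * m)
    have hF : ∀ m ∈ F, 0 < m ∧ b * sg m = a * m := fun m hm => (Finset.mem_filter.1 hm).2
    have hsum : ∑ m ∈ F0, fw a b m = ∑ m ∈ F, 1 / (m:ℝ) := by
      rw [Finset.sum_filter]
      refine Finset.sum_congr rfl fun m _ => ?_
      unfold fw
      split_ifs <;> rfl
    rw [hsum] at hF0
    obtain ⟨P0, hP0⟩ := lower_x a b hb k hkmono hkunb F hF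
    have hlim : Tendsto (fun x : ℝ => ∑ m ∈ F, ((Nat.primeCounting (⌊x⌋₊ / m) : ℝ) * Real.log x / x - P0 * (x ^ (0:ℝ) / (x / Real.log x)))) atTop
        (𝓝 (∑ m ∈ F, (1 / (m:ℝ) - P0 * 0))) := 
      tendsto_finsetSum _ fun m hm => (pi_div m (hF m hm).1).sub ((rpow_small 0 (by norm_num)).const_mul _)
    simp only [mul_zero, sub_zero] at hlim
    filter_upwards [hlim.eventually (lt_mem_nhds hF0), eventually_gt_atTop (1:ℝ)] with x hx hx1
    have hl : 0 < Real.log x := Real.log_pos hx1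
    refine hx.trans_le ?_
    have := hP0 x (S x) (fun n h1 h2 h3 => (hS x n).2 ⟨h1, h2, h3⟩)
    rw [le_div_iff₀ (by positivity)]
    refine le_trans (le_of_eq ?_) this
    rw [Finset.sum_mul]
    refine Finset.sum_congr rfl fun m _ => ?_
    rw [Real.rpow_zero]
    field_simp
  · have hlim : Tendsto (fun x : ℝ => x ^ (2/3 : ℝ) / (x / Real.log x) + ((perfSet a b ⌊x⌋₊).card : ℝ) / (x / Real.log x)
        + 18 * b * (x ^ (c + 2/3) / (x / Real.log x)) + 2 * (x ^ (5/6 : ℝ) / (x / Real.log x)) + ∑' m, hx a b x m) atTop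
        (𝓝 (0 + 0 + 18 * b * 0 + 2 * 0 + ∑' m, fw a b m)) :=
      (((((rpow_small _ (by norm_num)).add (perf_small a b ha hb)).add ((rpow_small _ (by linarith)).const_mul _)).add
        ((rpow_small _ (by norm_num)).const_mul _))).add (hx_tendsto a b ha hb)
    simp only [mul_zero, zero_add, add_zero] at hlim
    filter_upwards [hlim.eventually (gt_mem_nhds hv), upper_x a b ha hb c hc0 hc, eventually_gt_atTop (1:ℝ)] with x hx hu hx1
    refine (hu (S x) ?_).trans_lt hx
    intro n hn
    obtain ⟨h1, h2, h3⟩ := (hS x n).1 hn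
    refine ⟨h1, h2, ?_⟩
    have hn1 : (1:ℝ) ≤ n := by exact_mod_cast h1
    have h4 : k n ≤ x ^ c := (hkub n hn1).trans (Real.rpow_le_rpow (by linarith) h2 hc0.le)
    have : (b * sg n : ℝ) - a * n = b * ((sg n : ℝ) - (a / b : ℝ) * n) := by field_simp
    rw [this, abs_mul, abs_of_pos hbR]
    gcongr
    linarith

end WP
end Part7

theorem stmt_1 (c : ℝ) (hc : 0 < c) (hc' : c < 1 / 3)
    (k : ℝ → ℝ) (hkpos : ∀ y : ℝ, 1 ≤ y → 0 < k y)
    (hkmono : MonotoneOn k (Set.Ici 1))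
    (hkunb : ∀ M : ℝ, ∃ y : ℝ, 1 ≤ y ∧ M < k y)
    (hkub : ∀ y : ℝ, 1 ≤ y → k y ≤ y ^ c)
    (a b : ℕ) (ha : 0 < a) (hb : 0 < b) (hab : Nat.Coprime a b)
    (ℓ : ℝ) (hℓab : ℓ = (a : ℝ) / b) (hℓ : 1 < ℓ)
    (hmemSigma : ∃ m : ℕ, 0 < m ∧ (sigma1 m : ℝ) = ℓ * m)
    (δ : ℝ) (hδ : 0 < δ) (hklb : ∀ y : ℝ, 1 ≤ y → y ^ δ ≤ k y) :
    Summable (fun m : {m : ℕ // 0 < m ∧ (sigma1 m : ℝ) = ℓ * m} =>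
      1 / ((m : ℕ) : ℝ)) ∧
    Filter.Tendsto (fun x : ℝ => (withinPerfectCount ℓ k x : ℝ) / (x / Real.log x))
      Filter.atTop
      (nhds (∑' m : {m : ℕ // 0 < m ∧ (sigma1 m : ℝ) = ℓ * m}, 1 / ((m : ℕ) : ℝ))) := by
  subst hℓab
  have hbR : (0:ℝ) < b := by exact_mod_cast hb
  have hiff : ∀ m : ℕ, (sigma1 m : ℝ) = (a / b : ℝ) * m ↔ b * WP.sg m = a * m := by
    intro m
    have e : (sigma1 m : ℝ) = (WP.sg m : ℝ) := rfl
    rw [e, div_mul_eq_mul_div, eq_div_iff hbR.ne', mul_comm]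
    constructor
    · intro h; exact_mod_cast h
    · intro h; exact_mod_cast h
  have hind : Set.indicator {m : ℕ | 0 < m ∧ (sigma1 m : ℝ) = (a / b : ℝ) * m} (fun m : ℕ => 1 / (m : ℝ)) = WP.fw a b := by
    classical
    funext m
    unfold WP.fw
    rw [Set.indicator_apply]
    by_cases h : 0 < m ∧ b * WP.sg m = a * m
    · rw [if_pos h, if_pos]
      exact ⟨h.1, (hiff m).2 h.2⟩
    · rw [if_neg h, if_neg]
      exact fun h' => h ⟨h'.1, (hiff m).1 h'.2⟩
  have hsum := WP.fw_summable a b ha hb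
  have htsum : ∑' m : {m : ℕ // 0 < m ∧ (sigma1 m : ℝ) = (a / b : ℝ) * m}, 1 / ((m : ℕ) : ℝ) = ∑' m, WP.fw a b m := by
    rw [← hind]
    exact tsum_subtype {m : ℕ | 0 < m ∧ (sigma1 m : ℝ) = (a / b : ℝ) * m} (fun m : ℕ => 1 / (m : ℝ))
  refine ⟨?_, ?_⟩
  · rw [← hind] at hsum
    exact summable_subtype_iff_indicator.2 hsum
  · rw [htsum]
    have hfin : ∀ x : ℝ, {n : ℕ | 1 ≤ n ∧ (n : ℝ) ≤ x ∧ |(sigma1 n : ℝ) - (a / b : ℝ) * n| < k n}.Finite := by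
      intro x
      refine (Set.finite_Iic ⌊x⌋₊).subset fun n hn => ?_
      exact Set.mem_Iic.2 (Nat.le_floor hn.2.1)
    have := WP.main_limit a b ha hb c hc hc' k hkmono hkunb hkub (fun x => (hfin x).toFinset) (by
      intro x n
      rw [Set.Finite.mem_toFinset]
      exact Iff.rfl)
    refine this.congr fun x => ?_
    unfold withinPerfectCount
    rw [Set.ncard_eq_toFinset_card _ (hfin x)]
end
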